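/- arXiv:2202.07041 — 2 statements merged into one kernel-verified Lean document; each statement's English description precedes it below -/
import Mathlib

section
/- Let n > 0, ρ(z) = √(1−z²), and 2 < p ≤ 2n/(n−2) if n > 2 (any p > 2 if n ≤ 2). Then for all f ∈ H¹([−1,1], dν_n), ∫ |f'|² ρ² dν_n ≥ (n/(p−2)) ((∫ |f|^p dν_n)^{2/p} − ∫ |f|² dν_n). -/
open MeasureTheory Real

/-- The quadratic form produced by the Bakry–Émery computation for the ultraspherical operator is
nonnegative in the admissible range of exponents. -/
lemma ultraspherical_form_nonneg {n p : ℝ} (hn : 0 < n) (hp : 2 < p)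
    (hp' : 2 < n → p ≤ 2 * n / (n - 2)) (A B : ℝ) :
    0 ≤ A ^ 2 + ((2 - 2 * (p - 1) / (n + 2)) + (p - 1) - 3 * n * (p - 1) / (n + 2)) * B * A
      + ((2 - 2 * (p - 1) / (n + 2)) + (p - 1) - 1
        - n * (p - 1) / (n + 2) * (2 - 2 * (p - 1) / (n + 2))) * B ^ 2 := by
  have hn2 : 0 < n + 2 := by linarith
  have hq : (p - 1) * (n - 2) ≤ n + 2 := by
    rcases le_or_gt n 2 with h | h
    · nlinarith
    · have := hp' h
      rw [le_div_iff₀ (by linarith)] at this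
      linarith
  have key : A ^ 2 + ((2 - 2 * (p - 1) / (n + 2)) + (p - 1) - 3 * n * (p - 1) / (n + 2)) * B * A
      + ((2 - 2 * (p - 1) / (n + 2)) + (p - 1) - 1
        - n * (p - 1) / (n + 2) * (2 - 2 * (p - 1) / (n + 2))) * B ^ 2
      = (A + ((2 - 2 * (p - 1) / (n + 2)) + (p - 1) - 3 * n * (p - 1) / (n + 2)) / 2 * B) ^ 2
        + (p - 1) * n * (n + 2 - (p - 1) * (n - 2)) / (n + 2) ^ 2 * B ^ 2 := by
    field_simp
    ring
  rw [key]
  have : 0 ≤ (p - 1) * n * (n + 2 - (p - 1) * (n - 2)) / (n + 2) ^ 2 := by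
    apply div_nonneg _ (by positivity)
    exact mul_nonneg (mul_nonneg (by linarith) hn.le) (by linarith)
  positivity

/-- Rigidity: a positive solution of the truncated Neumann problem
`(ρⁿ U')' = ρⁿ⁻² (μ U - m U^(p-1))` with `μ < n / (p - 2)` is constant. -/
lemma ultraspherical_rigidity {n p a μ m : ℝ} (hn : 0 < n) (hp : 2 < p)
    (hp' : 2 < n → p ≤ 2 * n / (n - 2)) (ha1 : a < 1) (hμ : μ * (p - 2) < n)
    {U V : ℝ → ℝ}
    (hU : ∀ x ∈ Set.Icc (-a) a, HasDerivAt U (V x / (1 - x ^ 2) ^ (n / 2)) x)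
    (hV : ∀ x ∈ Set.Icc (-a) a,
      HasDerivAt V ((1 - x ^ 2) ^ ((n - 2) / 2) * (μ * U x - m * U x ^ (p - 1))) x)
    (hl : V (-a) = 0) (hr : V a = 0) (hpos : ∀ x ∈ Set.Icc (-a) a, 0 < U x) :
    ∀ x ∈ Set.Ioo (-a) a, V x = 0 := by
  set s : ℝ := 2 - 2 * (p - 1) / (n + 2) with hs
  set c : ℝ := - (n * (p - 1) / (n + 2)) with hc
  have hn2 : n + 2 ≠ 0 := by linarith
  have hN : ∀ x ∈ Set.Icc (-a) a, 0 < 1 - x ^ 2 := by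
    intro x hx
    have : |x| < 1 := (abs_le.2 hx).trans_lt ha1
    have := (sq_lt_one_iff_abs_lt_one x).2 this
    linarith
  set y : ℝ → ℝ := fun x => V x / (1 - x ^ 2) ^ (n / 2) / U x with hy
  set R : ℝ → ℝ := fun x => μ - m * U x ^ (p - 2) with hR
  set T : ℝ → ℝ := fun x => U x ^ s * ((1 - x ^ 2) ^ (n / 2) *
    (y x * (R x + n * x * y x + c * (1 - x ^ 2) * y x ^ 2))) with hT
  set A : ℝ → ℝ := fun x => (R x + n * x * y x) / (1 - x ^ 2) - y x ^ 2 with hA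
  set T' : ℝ → ℝ := fun x => U x ^ s * ((1 - x ^ 2) ^ (n / 2) *
    ((1 - x ^ 2) * (A x ^ 2 + (s + (p - 1) - 3 * n * (p - 1) / (n + 2)) * (y x ^ 2) * A x
      + (s + (p - 1) - 1 - n * (p - 1) / (n + 2) * s) * (y x ^ 2) ^ 2)
      + (n - μ * (p - 2)) * y x ^ 2)) with hT'
  have hderiv : ∀ x ∈ Set.Icc (-a) a, HasDerivAt T (T' x) x := by
    intro x hx
    have hNx := hN x hx
    have hUx := hpos x hx
    have hPx : 0 < (1 - x ^ 2) ^ (n / 2) := rpow_pos_of_pos hNx _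
    have dN : HasDerivAt (fun x : ℝ => 1 - x ^ 2) (-(2 * x)) x := by
      simpa using ((hasDerivAt_pow 2 x).const_sub 1)
    have dP : HasDerivAt (fun x : ℝ => (1 - x ^ 2) ^ (n / 2))
        (-(n * x) * (1 - x ^ 2) ^ (n / 2) / (1 - x ^ 2)) x := by
      refine HasDerivAt.congr_deriv (dN.rpow_const (p := n / 2) (Or.inl hNx.ne')) ?_
      rw [rpow_sub_one hNx.ne']
      ring
    have hUy : V x / (1 - x ^ 2) ^ (n / 2) = U x * y x := by
      simp only [hy]; field_simp
    have dU : HasDerivAt U (U x * y x) x := hUy ▸ hU x hx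
    have dUs : HasDerivAt (fun x => U x ^ s) (s * U x ^ s * y x) x := by
      refine HasDerivAt.congr_deriv (dU.rpow_const (p := s) (Or.inl hUx.ne')) ?_
      rw [rpow_sub_one hUx.ne']
      field_simp
    have dR : HasDerivAt R ((p - 2) * (R x - μ) * y x) x := by
      refine HasDerivAt.congr_deriv (((dU.rpow_const (p := p - 2) (Or.inl hUx.ne')).const_mul m).const_sub μ) ?_
      rw [rpow_sub_one hUx.ne']
      simp only [hR]
      field_simp
      ring
    have dy : HasDerivAt y (A x) x := by
      refine HasDerivAt.congr_deriv (((hV x hx).div dP hPx.ne').div dU hUx.ne') ?_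
      have h1 : U x ^ (p - 1) = U x ^ (p - 2) * U x := by
        rw [← rpow_add_one hUx.ne']; congr 1; ring
      have h2 : (1 - x ^ 2) ^ ((n - 2) / 2) = (1 - x ^ 2) ^ (n / 2) / (1 - x ^ 2) := by
        rw [← rpow_sub_one hNx.ne']; congr 1; ring
      have h3 : V x = (1 - x ^ 2) ^ (n / 2) * (U x * y x) := by
        rw [← hUy]; field_simp
      simp only [Pi.div_apply, h1, h2, h3, hA, hR]
      field_simp
      ring
    have dz := (hasDerivAt_id x).const_mul n
    have := dUs.mul (dP.mul (dy.mul ((dR.add (dz.mul dy)).add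
      ((dN.const_mul c).mul (dy.pow 2)))))
    refine this.congr_deriv ?_
    have hRA : R x = (1 - x ^ 2) * (A x + y x ^ 2) - n * x * y x := by
      simp only [hA]; field_simp; ring
    simp only [hT', Pi.add_apply, Pi.mul_apply, Pi.pow_apply, id]
    rw [hRA, hc]
    field_simp
    rw [hs]
    field_simp
    ring
  have hT'le : ∀ x ∈ Set.Icc (-a) a, 0 ≤ T' x ∧ (T' x = 0 → y x = 0) := by
    intro x hx
    have hNx := hN x hx
    have h1 : 0 < U x ^ s := rpow_pos_of_pos (hpos x hx) _
    have h2 : 0 < (1 - x ^ 2) ^ (n / 2) := rpow_pos_of_pos hNx _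
    have h3 := mul_nonneg hNx.le (ultraspherical_form_nonneg hn hp hp' (A x) (y x ^ 2))
    rw [← hs] at h3
    have h4 : 0 ≤ (n - μ * (p - 2)) * y x ^ 2 := mul_nonneg (by linarith) (sq_nonneg _)
    refine ⟨mul_nonneg h1.le (mul_nonneg h2.le (add_nonneg h3 h4)), fun h => ?_⟩
    have h5 := (mul_eq_zero.1 h).resolve_left h1.ne'
    have h6 := (mul_eq_zero.1 h5).resolve_left h2.ne'
    have h7 : (n - μ * (p - 2)) * y x ^ 2 = 0 := by linarith
    simpa [sub_ne_zero.2 hμ.ne'] using h7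
  have hmono : MonotoneOn T (Set.Icc (-a) a) := by
    apply monotoneOn_of_deriv_nonneg (convex_Icc _ _)
    · exact fun x hx => (hderiv x hx).continuousAt.continuousWithinAt
    · exact fun x hx => (hderiv x (interior_subset hx)).differentiableAt.differentiableWithinAt
    · intro x hx
      rw [(hderiv x (interior_subset hx)).deriv]
      exact (hT'le x (interior_subset hx)).1
  intro x hx
  have haa : -a ≤ a := (hx.1.trans hx.2).le
  have hzero : ∀ z ∈ Set.Icc (-a) a, T z = 0 := by
    intro z hz
    have h1 := hmono (Set.left_mem_Icc.2 haa) hz hz.1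
    have h2 := hmono hz (Set.right_mem_Icc.2 haa) hz.2
    have e1 : T (-a) = 0 := by simp [hT, hy, hl]
    have e2 : T a = 0 := by simp [hT, hy, hr]
    linarith
  have hxI := Set.Ioo_subset_Icc_self hx
  have hev : T =ᶠ[nhds x] fun _ => 0 := by
    filter_upwards [Icc_mem_nhds hx.1 hx.2] with z hz using hzero z hz
  have hT0 : T' x = 0 := (hderiv x hxI).unique ((hasDerivAt_const x 0).congr_of_eventuallyEq hev)
  have hy0 := (hT'le x hxI).2 hT0
  have h2 : (1 - x ^ 2) ^ (n / 2) ≠ 0 := (rpow_pos_of_pos (hN x hxI) _).ne'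
  simpa [hy, h2, (hpos x hxI).ne'] using hy0

/-- Differentiable functions whose derivative is square integrable between `l` and `r`. -/
def FiniteEnergy (l r : ℝ) (f : ℝ → ℝ) : Prop :=
  Differentiable ℝ f ∧ IntervalIntegrable (fun x => deriv f x ^ 2) volume l r

/-- The weighted Dirichlet energy with a zeroth order term. -/
noncomputable def weightedEnergy (P W : ℝ → ℝ) (μ l r : ℝ) (f : ℝ → ℝ) : ℝ :=
  ∫ x in l..r, (P x * deriv f x ^ 2 + μ * (W x * f x ^ 2))

lemma FiniteEnergy.intervalIntegrable_deriv {l r : ℝ} {f : ℝ → ℝ} (hf : FiniteEnergy l r f) :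
    IntervalIntegrable (deriv f) volume l r := by
  refine (hf.2.add (intervalIntegrable_const (c := (1 : ℝ)))).mono_fun
    (measurable_deriv f).aestronglyMeasurable (Filter.Eventually.of_forall fun x => ?_)
  simp only [norm_eq_abs]
  rw [abs_of_nonneg (a := _ + (1 : ℝ)) (by positivity)]
  nlinarith [sq_abs (deriv f x), sq_nonneg (|deriv f x| - 1)]

lemma FiniteEnergy.mono {l r x y : ℝ} {f : ℝ → ℝ} (hf : FiniteEnergy l r f)
    (hlx : l ≤ x) (hxy : x ≤ y) (hyr : y ≤ r) : FiniteEnergy x y f := by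
  refine ⟨hf.1, hf.2.mono_set ?_⟩
  rw [Set.uIcc_of_le hxy, Set.uIcc_of_le (hlx.trans (hxy.trans hyr))]
  exact Set.Icc_subset_Icc hlx hyr

lemma FiniteEnergy.abs_sub_le {l r x y η : ℝ} {f : ℝ → ℝ} (hf : FiniteEnergy l r f)
    (hx : x ∈ Set.Icc l r) (hy : y ∈ Set.Icc l r) (hη : 0 < η) :
    |f x - f y| ≤ η * |x - y| / 2 + (∫ z in l..r, deriv f z ^ 2) / (2 * η) := by
  wlog hxy : y ≤ x generalizing x y
  · rw [abs_sub_comm, abs_sub_comm x]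
    exact this hy hx (le_of_not_ge hxy)
  have hm := hf.mono hy.1 hxy hx.2
  have hi := hm.intervalIntegrable_deriv
  rw [← intervalIntegral.integral_deriv_eq_sub (fun z _ => hf.1 z) hi,
    abs_of_nonneg (sub_nonneg.2 hxy)]
  have h1 : |∫ z in y..x, deriv f z| ≤ ∫ z in y..x, |deriv f z| :=
    intervalIntegral.abs_integral_le_integral_abs hxy
  have h2 : ∫ z in y..x, |deriv f z| ≤ ∫ z in y..x, (η / 2 + deriv f z ^ 2 / (2 * η)) := by
    refine intervalIntegral.integral_mono_on hxy hi.abs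
      (intervalIntegrable_const.add (hm.2.div_const _)) fun z _ => ?_
    have : η / 2 + deriv f z ^ 2 / (2 * η) - |deriv f z| = (η - |deriv f z|) ^ 2 / (2 * η) := by
      rw [← sq_abs (deriv f z)]; field_simp; ring
    have h0 : 0 ≤ (η - |deriv f z|) ^ 2 / (2 * η) := by positivity
    linarith
  have h3 : ∫ z in y..x, (η / 2 + deriv f z ^ 2 / (2 * η))
      = η * (x - y) / 2 + (∫ z in y..x, deriv f z ^ 2) / (2 * η) := by
    rw [intervalIntegral.integral_add intervalIntegrable_const (hm.2.div_const _)]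
    simp only [intervalIntegral.integral_div, intervalIntegral.integral_const, smul_eq_mul]
    ring
  have h4 : ∫ z in y..x, deriv f z ^ 2 ≤ ∫ z in l..r, deriv f z ^ 2 := by
    refine intervalIntegral.integral_mono_interval hy.1 hxy hx.2
      (Filter.Eventually.of_forall fun z => sq_nonneg _) hf.2
  have h5 : (∫ z in y..x, deriv f z ^ 2) / (2 * η) ≤ (∫ z in l..r, deriv f z ^ 2) / (2 * η) := by
    gcongr
  linarith

section
variable {l r μ : ℝ} {P W : ℝ → ℝ}

lemma FiniteEnergy.intervalIntegrable_energy {f : ℝ → ℝ} (hf : FiniteEnergy l r f)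
    (hP : Continuous P) (hW : Continuous W) :
    IntervalIntegrable (fun x => P x * deriv f x ^ 2 + μ * (W x * f x ^ 2)) volume l r := by
  refine (hf.2.continuousOn_mul hP.continuousOn).add ?_
  have := hf.1.continuous
  exact Continuous.intervalIntegrable (by fun_prop) _ _

lemma weightedEnergy_nonneg (hlr : l ≤ r) (hP : ∀ x, 0 < P x) (hW : ∀ x, 0 < W x) (hμ : 0 < μ)
    (f : ℝ → ℝ) : 0 ≤ weightedEnergy P W μ l r f := by
  refine intervalIntegral.integral_nonneg hlr fun x _ => ?_
  have := hP x
  have := hW x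
  positivity

lemma FiniteEnergy.add_smul {f φ : ℝ → ℝ} (hf : FiniteEnergy l r f) (hφ : Differentiable ℝ φ)
    (hφ' : Continuous (deriv φ)) (t : ℝ) : FiniteEnergy l r (fun x => f x + t * φ x) := by
  refine ⟨hf.1.add (hφ.const_mul t), ?_⟩
  have hd : (fun x => deriv (fun x => f x + t * φ x) x ^ 2)
      = fun x => deriv f x ^ 2 + (2 * t * deriv φ x) * deriv f x + t ^ 2 * deriv φ x ^ 2 := by
    ext x
    rw [((hf.1 x).hasDerivAt.fun_add ((hφ x).hasDerivAt.const_mul t)).deriv]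
    ring
  rw [hd]
  exact (hf.2.add (hf.intervalIntegrable_deriv.continuousOn_mul (by fun_prop))).add
    (Continuous.intervalIntegrable (by fun_prop) _ _)

lemma FiniteEnergy.weightedEnergy_add_smul {f φ : ℝ → ℝ} (hf : FiniteEnergy l r f)
    (hP : Continuous P) (hW : Continuous W)
    (hφ : Differentiable ℝ φ) (hφ' : Continuous (deriv φ)) (t : ℝ) :
    weightedEnergy P W μ l r (fun x => f x + t * φ x)
      = weightedEnergy P W μ l r f
        + 2 * t * (∫ x in l..r, (P x * deriv φ x * deriv f x + μ * (W x * f x * φ x)))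
        + t ^ 2 * weightedEnergy P W μ l r φ := by
  have hd : (fun x => P x * deriv (fun x => f x + t * φ x) x ^ 2
        + μ * (W x * (f x + t * φ x) ^ 2))
      = fun x => ((P x * deriv f x ^ 2 + μ * (W x * f x ^ 2))
        + 2 * t * (P x * deriv φ x * deriv f x + μ * (W x * f x * φ x)))
        + t ^ 2 * (P x * deriv φ x ^ 2 + μ * (W x * φ x ^ 2)) := by
    ext x
    rw [((hf.1 x).hasDerivAt.fun_add ((hφ x).hasDerivAt.const_mul t)).deriv]
    ring
  have hfc := hf.1.continuous
  have hφc := hφ.continuous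
  have i1 := hf.intervalIntegrable_energy (μ := μ) hP hW
  have i2 : IntervalIntegrable
      (fun x => P x * deriv φ x * deriv f x + μ * (W x * f x * φ x)) volume l r :=
    (hf.intervalIntegrable_deriv.continuousOn_mul (by fun_prop)).add
      (Continuous.intervalIntegrable (by fun_prop) _ _)
  have i3 : IntervalIntegrable
      (fun x => P x * deriv φ x ^ 2 + μ * (W x * φ x ^ 2)) volume l r :=
    Continuous.intervalIntegrable (by fun_prop) _ _
  rw [weightedEnergy, hd, intervalIntegral.integral_add (i1.add (i2.const_mul _))
    (i3.const_mul _), intervalIntegral.integral_add i1 (i2.const_mul _),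
    intervalIntegral.integral_const_mul, intervalIntegral.integral_const_mul]
  rfl

lemma FiniteEnergy.const_mul {f : ℝ → ℝ} (hf : FiniteEnergy l r f) (c : ℝ) :
    FiniteEnergy l r (fun x => c * f x) := by
  refine ⟨hf.1.const_mul c, ?_⟩
  have hd : (fun x => deriv (fun x => c * f x) x ^ 2) = fun x => c ^ 2 * deriv f x ^ 2 := by
    ext x
    rw [((hf.1 x).hasDerivAt.const_mul c).deriv, mul_pow]
  rw [hd]
  exact hf.2.const_mul _

lemma FiniteEnergy.weightedEnergy_const_mul {f : ℝ → ℝ} (hf : FiniteEnergy l r f) (c : ℝ) :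
    weightedEnergy P W μ l r (fun x => c * f x) = c ^ 2 * weightedEnergy P W μ l r f := by
  rw [weightedEnergy, weightedEnergy, ← intervalIntegral.integral_const_mul]
  congr 1
  ext x
  rw [((hf.1 x).hasDerivAt.const_mul c).deriv]
  ring

/-- The regularised absolute value `√(f² + ε)` costs at most `μ ε ∫ W` energy. -/
lemma FiniteEnergy.sqrt_sq_add {f : ℝ → ℝ} (hf : FiniteEnergy l r f) (hlr : l ≤ r)
    (hP : Continuous P) (hW : Continuous W) (hP0 : ∀ x, 0 < P x) {ε : ℝ} (hε : 0 < ε) :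
    FiniteEnergy l r (fun x => √(f x ^ 2 + ε)) ∧
      weightedEnergy P W μ l r (fun x => √(f x ^ 2 + ε))
        ≤ weightedEnergy P W μ l r f + ε * (μ * ∫ x in l..r, W x) := by
  have hpos : ∀ x, 0 < f x ^ 2 + ε := fun x => by positivity
  have hd : ∀ x, HasDerivAt (fun x => √(f x ^ 2 + ε)) (f x * deriv f x / √(f x ^ 2 + ε)) x := by
    intro x
    refine ((((hf.1 x).hasDerivAt.pow 2).add_const ε).sqrt (hpos x).ne').congr_deriv ?_
    have := sqrt_pos.2 (hpos x)
    simp only [Pi.pow_apply]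
    field_simp
    simp
    ring
  have hle : ∀ x, deriv (fun x => √(f x ^ 2 + ε)) x ^ 2 ≤ deriv f x ^ 2 := by
    intro x
    rw [(hd x).deriv, div_pow, sq_sqrt (hpos x).le, div_le_iff₀ (hpos x)]
    nlinarith [sq_nonneg (deriv f x)]
  have hFE : FiniteEnergy l r (fun x => √(f x ^ 2 + ε)) := by
    refine ⟨fun x => (hd x).differentiableAt, hf.2.mono_fun
      ((measurable_deriv _).pow_const 2).aestronglyMeasurable
      (Filter.Eventually.of_forall fun x => ?_)⟩
    simp only [norm_eq_abs]
    rw [abs_of_nonneg (sq_nonneg _), abs_of_nonneg (sq_nonneg _)]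
    exact hle x
  refine ⟨hFE, ?_⟩
  rw [← intervalIntegral.integral_const_mul, ← intervalIntegral.integral_const_mul,
    weightedEnergy, weightedEnergy, ← intervalIntegral.integral_add
      (hf.intervalIntegrable_energy hP hW)
      (((hW.intervalIntegrable _ _).const_mul _).const_mul _)]
  refine intervalIntegral.integral_mono_on hlr (hFE.intervalIntegrable_energy hP hW)
    ((hf.intervalIntegrable_energy hP hW).add
      (((hW.intervalIntegrable _ _).const_mul _).const_mul _)) fun x _ => ?_
  rw [sq_sqrt (hpos x).le]
  have := mul_le_mul_of_nonneg_left (hle x) (hP0 x).le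
  linarith

/-- Functions of bounded energy are bounded and uniformly controlled in oscillation. -/
lemma exists_energy_bounds (hlr : l < r) (hP : Continuous P) (hW : Continuous W)
    (hP0 : ∀ x, 0 < P x) (hW0 : ∀ x, 0 < W x) (hμ : 0 < μ) (K : ℝ) :
    ∃ C E : ℝ, 0 < E ∧ ∀ f, FiniteEnergy l r f → weightedEnergy P W μ l r f ≤ K →
      (∀ x ∈ Set.Icc l r, |f x| ≤ C) ∧ ∫ z in l..r, deriv f z ^ 2 ≤ E := by
  obtain ⟨x₀, -, hx₀⟩ := isCompact_Icc.exists_isMinOn (Set.nonempty_Icc.2 hlr.le)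
    (hP.continuousOn (s := Set.Icc l r))
  have hM : 0 < ∫ x in l..r, W x :=
    intervalIntegral.intervalIntegral_pos_of_pos (hW.intervalIntegrable _ _) hW0 hlr
  set E := |K| / P x₀ + 1 with hE
  have hE0 : 0 < E := by have := hP0 x₀; positivity
  set D := (|K| + 1) / (μ * ∫ x in l..r, W x) with hD
  have hD0 : 0 < D := by positivity
  refine ⟨√D + (1 * |r - l| / 2 + E / (2 * 1)), E, hE0, fun f hf hK => ?_⟩
  have hfc := hf.1.continuous
  have i1 : IntervalIntegrable (fun x => P x * deriv f x ^ 2) volume l r :=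
    hf.2.continuousOn_mul hP.continuousOn
  have i2 : IntervalIntegrable (fun x => μ * (W x * f x ^ 2)) volume l r :=
    Continuous.intervalIntegrable (by fun_prop) _ _
  rw [weightedEnergy, intervalIntegral.integral_add i1 i2] at hK
  have p1 : 0 ≤ ∫ x in l..r, P x * deriv f x ^ 2 :=
    intervalIntegral.integral_nonneg hlr.le fun x _ => by have := hP0 x; positivity
  have p2 : 0 ≤ ∫ x in l..r, μ * (W x * f x ^ 2) :=
    intervalIntegral.integral_nonneg hlr.le fun x _ => by have := hW0 x; positivity
  have hder : ∫ z in l..r, deriv f z ^ 2 ≤ E := by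
    have : P x₀ * ∫ z in l..r, deriv f z ^ 2 ≤ ∫ x in l..r, P x * deriv f x ^ 2 := by
      rw [← intervalIntegral.integral_const_mul]
      refine intervalIntegral.integral_mono_on hlr.le (hf.2.const_mul _) i1 fun x hx => ?_
      exact mul_le_mul_of_nonneg_right (hx₀ hx) (sq_nonneg _)
    have h2 : (∫ z in l..r, deriv f z ^ 2) ≤ |K| / P x₀ := by
      rw [le_div_iff₀ (hP0 x₀)]
      linarith [le_abs_self K]
    linarith
  refine ⟨fun x hx => ?_, hder⟩
  obtain ⟨y, hy, hyD⟩ : ∃ y ∈ Set.Icc l r, f y ^ 2 ≤ D := by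
    by_contra! hcon
    have : ∫ x in l..r, μ * (W x * D) ≤ ∫ x in l..r, μ * (W x * f x ^ 2) := by
      refine intervalIntegral.integral_mono_on hlr.le
        (Continuous.intervalIntegrable (by fun_prop) _ _) i2 fun x hx => ?_
      have := hcon x hx
      have := hW0 x
      gcongr
    rw [intervalIntegral.integral_const_mul, intervalIntegral.integral_mul_const, ← mul_assoc,
      hD, mul_div_cancel₀ _ (by positivity)] at this
    linarith [le_abs_self K]
  have h1 := hf.abs_sub_le hx hy one_pos
  have h2 : |f y| ≤ √D := abs_le_sqrt hyD
  have h3 : |x - y| ≤ |r - l| := by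
    rw [abs_of_pos (sub_pos.2 hlr), abs_le]
    constructor <;> linarith [hx.1, hx.2, hy.1, hy.2]
  have h4 : |f x| ≤ |f y| + |f x - f y| := by
    have := abs_add_le (f y) (f x - f y)
    simpa using this
  have h5 : (∫ z in l..r, deriv f z ^ 2) / (2 * 1) ≤ E / (2 * 1) := by gcongr
  linarith

end

/-- A sequence of bounded functions with uniformly bounded energy has a pointwise convergent
subsequence with a continuous limit. -/
lemma exists_subseq_tendsto_of_finiteEnergy {l r : ℝ} (hlr : l < r) {g : ℕ → ℝ → ℝ} {C E : ℝ}
    (hE : 0 < E) (hg : ∀ k, FiniteEnergy l r (g k)) (hC : ∀ k, ∀ x ∈ Set.Icc l r, |g k x| ≤ C)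
    (hgE : ∀ k, ∫ z in l..r, deriv (g k) z ^ 2 ≤ E) :
    ∃ u : ℝ → ℝ, Continuous u ∧ ∃ σ : ℕ → ℕ, StrictMono σ ∧
      ∀ x ∈ Set.Icc l r, Filter.Tendsto (fun k => g (σ k) x) Filter.atTop (nhds (u x)) := by
  let G : ℕ → BoundedContinuousFunction (Set.Icc l r) ℝ := fun k =>
    BoundedContinuousFunction.mkOfCompact
      ⟨fun x => g k x, (hg k).1.continuous.comp continuous_subtype_val⟩
  have hG : ∀ k x, G k x = g k x := fun k x => rfl
  have hequi : Equicontinuous ((↑) : Set.range G → Set.Icc l r → ℝ) := by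
    intro x₀
    rw [Metric.equicontinuousAt_iff_right]
    intro ε hε
    have hev : ∀ᶠ x in nhds x₀, dist x x₀ < ε ^ 2 / (2 * E) :=
      Metric.eventually_nhds_iff.2 ⟨_, by positivity, fun _ h => h⟩
    filter_upwards [hev] with x hx
    rintro ⟨-, k, rfl⟩
    simp only [hG]
    rw [Real.dist_eq, abs_sub_comm]
    rw [Subtype.dist_eq, Real.dist_eq] at hx
    have h1 := (hg k).abs_sub_le x.2 x₀.2 (η := E / ε) (by positivity)
    have h2 : (∫ z in l..r, deriv (g k) z ^ 2) / (2 * (E / ε)) ≤ E / (2 * (E / ε)) := by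
      gcongr
      exact hgE k
    have h3 : E / (2 * (E / ε)) = ε / 2 := by field_simp
    have h4 : E / ε * |(x : ℝ) - x₀| / 2 < ε / 2 := by
      have : E / ε * |(x : ℝ) - x₀| < E / ε * (ε ^ 2 / (2 * E)) := by gcongr
      have h5 : E / ε * (ε ^ 2 / (2 * E)) = ε / 2 := by field_simp
      linarith
    linarith
  have hcomp := BoundedContinuousFunction.arzela_ascoli (Set.Icc (-C) C) isCompact_Icc
    (Set.range G) (by
      rintro _ x ⟨k, rfl⟩
      exact abs_le.1 (hC k x x.2)) hequi
  obtain ⟨v, -, σ, hσ, hlim⟩ :=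
    hcomp.tendsto_subseq fun k => subset_closure (Set.mem_range_self k)
  refine ⟨Set.IccExtend hlr.le v, v.continuous.Icc_extend', σ, hσ, fun x hx => ?_⟩
  rw [Set.IccExtend_of_mem _ _ hx]
  exact (BoundedContinuousFunction.tendsto_iff_tendstoUniformly.1 hlim).tendsto_at ⟨x, hx⟩

lemma tendsto_intervalIntegral_comp {l r : ℝ} (hlr : l ≤ r) {g : ℕ → ℝ → ℝ} {u Φ ψ : ℝ → ℝ} {C : ℝ}
    (hg : ∀ k, Continuous (g k)) (hC : ∀ k, ∀ x ∈ Set.Icc l r, |g k x| ≤ C)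
    (hlim : ∀ x ∈ Set.Icc l r, Filter.Tendsto (fun k => g k x) Filter.atTop (nhds (u x)))
    (hΦ : Continuous Φ) (hψ : Continuous ψ) :
    Filter.Tendsto (fun k => ∫ x in l..r, ψ x * Φ (g k x)) Filter.atTop
      (nhds (∫ x in l..r, ψ x * Φ (u x))) := by
  obtain ⟨D, hD⟩ := isCompact_Icc.exists_bound_of_continuousOn (hΦ.continuousOn (s := Set.Icc (-C) C))
  refine intervalIntegral.tendsto_integral_filter_of_dominated_convergence (fun x => |ψ x| * D)
    ?_ ?_ ?_ ?_
  · refine Filter.Eventually.of_forall fun k => ?_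
    have := hg k
    exact Continuous.aestronglyMeasurable (by fun_prop)
  · refine Filter.Eventually.of_forall fun k => Filter.Eventually.of_forall fun x hx => ?_
    rw [Set.uIoc_of_le hlr] at hx
    rw [norm_mul, norm_eq_abs]
    exact mul_le_mul_of_nonneg_left (hD _ (abs_le.1 (hC k x (Set.Ioc_subset_Icc_self hx))))
      (abs_nonneg _)
  · exact Continuous.intervalIntegrable (by fun_prop) _ _
  · refine Filter.Eventually.of_forall fun x hx => ?_
    rw [Set.uIoc_of_le hlr] at hx
    exact ((hΦ.tendsto _).comp (hlim x (Set.Ioc_subset_Icc_self hx))).const_mul _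

lemma rpow_add_mul_le_abs_rpow {p x : ℝ} (hp : 1 < p) (hx : 0 ≤ x) (h : ℝ) :
    x ^ p + p * (x ^ (p - 1) * h) ≤ |x + h| ^ p := by
  rcases hx.eq_or_lt with rfl | hx
  · rw [zero_rpow (by linarith), zero_rpow (by linarith)]
    simpa using rpow_nonneg (abs_nonneg h) p
  · have hs : -1 ≤ (|x + h| - x) / x := by
      rw [le_div_iff₀ hx]; linarith [abs_nonneg (x + h)]
    have h1 := one_add_mul_self_le_rpow_one_add hs hp.le
    have h2 : 1 + (|x + h| - x) / x = |x + h| / x := by field_simp; ring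
    rw [h2, div_rpow (abs_nonneg _) hx.le, le_div_iff₀ (rpow_pos_of_pos hx _)] at h1
    have h3 : x ^ p = x ^ (p - 1) * x := by rw [← rpow_add_one hx.ne']; congr 1; ring
    have h4 : (1 + p * ((|x + h| - x) / x)) * x ^ p
        = x ^ p + p * (x ^ (p - 1) * (|x + h| - x)) := by
      rw [h3]; field_simp
    rw [h4] at h1
    refine le_trans ?_ h1
    have : h ≤ |x + h| - x := by linarith [le_abs_self (x + h)]
    gcongr

lemma eq_of_forall_rpow_le {m p K B D : ℝ} (hp : 0 < p)
    (h : ∀ t, 0 < 1 + p * t * K → m * (1 + p * t * K) ^ (2 / p) ≤ m + 2 * t * B + t ^ 2 * D) :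
    B = m * K := by
  set F : ℝ → ℝ := fun t => m + 2 * t * B + t ^ 2 * D - m * (1 + p * t * K) ^ (2 / p) with hF
  have hlin : HasDerivAt (fun t : ℝ => 1 + p * t * K) (p * K) 0 := by
    simpa using (((hasDerivAt_id (0 : ℝ)).const_mul p).mul_const K).const_add 1
  have hd : HasDerivAt F (2 * B - m * (p * K * (2 / p))) 0 := by
    have h1 := (hlin.rpow_const (p := 2 / p) (Or.inl (by simp))).const_mul m
    have h2 : HasDerivAt (fun t : ℝ => m + 2 * t * B + t ^ 2 * D) (2 * B) 0 := by
      have := ((((hasDerivAt_id (0 : ℝ)).const_mul 2).mul_const B).const_add m).fun_add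
        ((hasDerivAt_pow 2 (0 : ℝ)).mul_const D)
      simpa using this
    refine (h2.fun_sub h1).congr_deriv ?_
    simp
  have hmin : IsLocalMin F 0 := by
    have hpos : ∀ᶠ t in nhds (0 : ℝ), 0 < 1 + p * t * K :=
      hlin.continuousAt.eventually_const_lt (by simp)
    filter_upwards [hpos] with t ht
    have := h t ht
    have h0 : F 0 = 0 := by simp [hF]
    rw [h0]
    simp only [hF]
    linarith
  have := hmin.hasDerivAt_eq_zero hd
  field_simp at this
  linarith

section
variable {l r μ p : ℝ} {P W : ℝ → ℝ}

/-- Test functions with prescribed divergence `k`, normalised at the left end point. -/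
lemma hasDerivAt_testFunction (hP : Continuous P) (hP0 : ∀ x, 0 < P x) {k : ℝ → ℝ}
    (hk : Continuous k) (c x : ℝ) :
    HasDerivAt (fun x => c + ∫ z in l..x, (∫ y in l..z, k y) / P z)
      ((∫ y in l..x, k y) / P x) x := by
  have h1 : Continuous fun z => ∫ y in l..z, k y :=
    intervalIntegral.continuous_primitive (fun a b => hk.intervalIntegrable a b) l
  have h2 : Continuous fun z => (∫ y in l..z, k y) / P z :=
    h1.div hP fun x => (hP0 x).ne'
  exact (h2.integral_hasStrictDerivAt l x).hasDerivAt.const_add c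

lemma FiniteEnergy.integral_mul_deriv {f k : ℝ → ℝ} (hf : FiniteEnergy l r f)
    (hk : Continuous k) (hk0 : ∫ x in l..r, k x = 0) :
    ∫ x in l..r, (∫ y in l..x, k y) * deriv f x = - ∫ x in l..r, k x * f x := by
  rw [intervalIntegral.integral_mul_deriv_eq_deriv_mul
    (fun x _ => (hk.integral_hasStrictDerivAt l x).hasDerivAt) (fun x _ => (hf.1 x).hasDerivAt)
    (hk.intervalIntegrable _ _) hf.intervalIntegrable_deriv]
  simp [hk0]

lemma abs_rpow_inv_mul {I x : ℝ} (hI : 0 < I) (hp : 0 < p) :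
    |I ^ (-(1 / p)) * x| ^ p = I⁻¹ * |x| ^ p := by
  have : 0 < I ^ (-(1 / p)) := rpow_pos_of_pos hI _
  rw [abs_mul, abs_of_pos this, mul_rpow this.le (abs_nonneg _), ← rpow_mul hI.le]
  congr 1
  rw [← rpow_neg_one]
  congr 1
  field_simp

/-- The best constant in the weighted inequality is attained by a nonnegative continuous weak
solution of the Euler–Lagrange equation. -/
lemma exists_weak_minimizer (hlr : l < r) (hP : Continuous P) (hW : Continuous W)
    (hP0 : ∀ x, 0 < P x) (hW0 : ∀ x, 0 < W x) (hμ : 0 < μ) (hp : 2 < p) :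
    ∃ (m : ℝ) (u : ℝ → ℝ), Continuous u ∧ (∀ x ∈ Set.Icc l r, 0 ≤ u x) ∧
      (∀ f, FiniteEnergy l r f →
        m * (∫ x in l..r, W x * |f x| ^ p) ^ (2 / p) ≤ weightedEnergy P W μ l r f) ∧
      1 ≤ ∫ x in l..r, W x * |u x| ^ p ∧
      m * (∫ x in l..r, W x * |u x| ^ p) ^ (2 / p) ≤ m ∧
      ∀ (k : ℝ → ℝ) (c : ℝ), Continuous k → ∫ x in l..r, k x = 0 →
        (∫ x in l..r, (μ * (W x * u x) - m * (W x * |u x| ^ (p - 1)))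
          * (c + ∫ z in l..x, (∫ y in l..z, k y) / P z)) = ∫ x in l..r, k x * u x := by
  have hp0 : 0 < p := by linarith
  set Q := weightedEnergy P W μ l r with hQ
  set I : (ℝ → ℝ) → ℝ := fun f => ∫ x in l..r, W x * |f x| ^ p with hI
  have hcpow : Continuous fun x : ℝ => |x| ^ p := continuous_abs.rpow_const fun _ => Or.inr hp0.le
  have hcpow1 : Continuous fun x : ℝ => |x| ^ (p - 1) :=
    continuous_abs.rpow_const fun _ => Or.inr (by linarith)
  have hcI : ∀ f : ℝ → ℝ, Continuous f → Continuous fun x => W x * |f x| ^ p :=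
    fun f hf => hW.mul (hcpow.comp hf)
  have hI0 : ∀ f, 0 ≤ I f := fun f => intervalIntegral.integral_nonneg hlr.le fun x _ =>
    mul_nonneg (hW0 x).le (rpow_nonneg (abs_nonneg _) _)
  have hscale : ∀ f, 0 < I f → I (fun x => I f ^ (-(1 / p)) * f x) = 1 := by
    intro f hf
    have : I (fun x => I f ^ (-(1 / p)) * f x) = (I f)⁻¹ * I f := by
      simp only [hI]
      rw [← intervalIntegral.integral_const_mul]
      congr 1
      ext x
      rw [abs_rpow_inv_mul hf hp0]
      ring
    rw [this, inv_mul_cancel₀ hf.ne']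
  set S : Set ℝ := {q | ∃ f, FiniteEnergy l r f ∧ 1 ≤ I f ∧ q = Q f} with hS
  have hbdd : BddBelow S := ⟨0, by
    rintro _ ⟨f, -, -, rfl⟩
    exact weightedEnergy_nonneg hlr.le hP0 hW0 hμ f⟩
  have hM : 0 < ∫ x in l..r, W x :=
    intervalIntegral.intervalIntegral_pos_of_pos (hW.intervalIntegrable _ _) hW0 hlr
  have hone : FiniteEnergy l r (fun _ => (1 : ℝ)) :=
    ⟨differentiable_const _, by simp⟩
  have hne : S.Nonempty := by
    have h1 : 0 < I (fun _ => (1 : ℝ)) := by simpa [hI] using hM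
    exact ⟨_, _, hone.const_mul _, (hscale _ h1).ge, rfl⟩
  set m := sInf S with hm
  have hm0 : 0 ≤ m := le_csInf hne (by
    rintro _ ⟨f, -, -, rfl⟩
    exact weightedEnergy_nonneg hlr.le hP0 hW0 hμ f)
  have hmin : ∀ f, FiniteEnergy l r f → m * I f ^ (2 / p) ≤ Q f := by
    intro f hf
    rcases (hI0 f).eq_or_lt with h0 | h0
    · rw [← h0, zero_rpow (by positivity), mul_zero]
      exact weightedEnergy_nonneg hlr.le hP0 hW0 hμ f
    · have h1 : m ≤ Q (fun x => I f ^ (-(1 / p)) * f x) :=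
        csInf_le hbdd ⟨_, hf.const_mul _, (hscale f h0).ge, rfl⟩
      rw [hQ, hf.weightedEnergy_const_mul, ← rpow_natCast, ← rpow_mul h0.le] at h1
      have h2 : I f ^ (-(1 / p) * (2 : ℕ)) * I f ^ (2 / p) = 1 := by
        rw [← rpow_add h0]
        convert rpow_zero (I f) using 2
        push_cast; ring
      calc m * I f ^ (2 / p)
          ≤ I f ^ (-(1 / p) * (2 : ℕ)) * Q f * I f ^ (2 / p) := by gcongr
        _ = (I f ^ (-(1 / p) * (2 : ℕ)) * I f ^ (2 / p)) * Q f := by ring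
        _ = Q f := by rw [h2, one_mul]
  have hseq : ∀ k : ℕ, ∃ g, FiniteEnergy l r g ∧ (∀ x, 0 ≤ g x) ∧ 1 ≤ I g ∧
      Q g ≤ m + 1 / ((k : ℝ) + 1) * (1 + μ * ∫ x in l..r, W x) := by
    intro k
    have hk : (0 : ℝ) < 1 / ((k : ℝ) + 1) := by positivity
    obtain ⟨_, ⟨f, hf, hf1, rfl⟩, hlt⟩ := exists_lt_of_csInf_lt hne
      (show sInf S < m + 1 / ((k : ℝ) + 1) by rw [← hm]; linarith)
    obtain ⟨hg, hgQ⟩ := hf.sqrt_sq_add (μ := μ) hlr.le hP hW hP0 hk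
    refine ⟨_, hg, fun x => sqrt_nonneg _, hf1.trans ?_, ?_⟩
    · refine intervalIntegral.integral_mono_on hlr.le
        ((hcI _ hf.1.continuous).intervalIntegrable _ _)
        ((hcI _ hg.1.continuous).intervalIntegrable _ _) fun x _ => ?_
      have h1 : |f x| ≤ |√(f x ^ 2 + 1 / ((k : ℝ) + 1))| := by
        rw [abs_of_nonneg (sqrt_nonneg _)]
        exact abs_le_sqrt (by linarith)
      have := (hW0 x).le
      gcongr
    · simp only [hQ] at hlt ⊢
      linarith
  choose g hgF hg0 hg1 hgQ using hseq
  have hgS : ∀ k, m ≤ Q (g k) := fun k => csInf_le hbdd ⟨_, hgF k, hg1 k, rfl⟩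
  have hμM : 0 < 1 + μ * ∫ x in l..r, W x := by positivity
  have hgK : ∀ k, Q (g k) ≤ m + (1 + μ * ∫ x in l..r, W x) := fun k => by
    have : 1 / ((k : ℝ) + 1) ≤ 1 := by
      rw [div_le_one (by positivity)]; linarith [k.cast_nonneg (α := ℝ)]
    have := hgQ k
    nlinarith
  have hQlim : Filter.Tendsto (fun k => Q (g k)) Filter.atTop (nhds m) := by
    refine tendsto_of_tendsto_of_tendsto_of_le_of_le tendsto_const_nhds ?_ hgS hgQ
    have := (tendsto_one_div_add_atTop_nhds_zero_nat (𝕜 := ℝ)).mul_const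
      (1 + μ * ∫ x in l..r, W x)
    simpa using this.const_add m
  obtain ⟨C, E, hE, hbound⟩ := exists_energy_bounds hlr hP hW hP0 hW0 hμ
    (m + (1 + μ * ∫ x in l..r, W x))
  have hgC := fun k => (hbound (g k) (hgF k) (hgK k)).1
  obtain ⟨u, hu, σ, hσ, hlim⟩ := exists_subseq_tendsto_of_finiteEnergy hlr hE hgF hgC
    (fun k => (hbound (g k) (hgF k) (hgK k)).2)
  have hgc : ∀ k, Continuous (g (σ k)) := fun k => (hgF _).1.continuous
  have hQlim' := hQlim.comp hσ.tendsto_atTop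
  have hIlim : Filter.Tendsto (fun k => I (g (σ k))) Filter.atTop (nhds (I u)) :=
    tendsto_intervalIntegral_comp hlr.le hgc (fun k => hgC _) hlim hcpow hW
  have hIu : 1 ≤ I u := ge_of_tendsto' hIlim fun k => hg1 _
  refine ⟨m, u, hu, fun x hx => ge_of_tendsto' (hlim x hx) fun k => hg0 _ x, hmin, hIu, ?_, ?_⟩
  · exact le_of_tendsto_of_tendsto'
      ((hIlim.rpow_const (Or.inr (by positivity))).const_mul m) hQlim' fun k => hmin _ (hgF _)
  intro k c hk hk0
  set φ : ℝ → ℝ := fun x => c + ∫ z in l..x, (∫ y in l..z, k y) / P z with hφ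
  have hφd := hasDerivAt_testFunction (l := l) hP hP0 hk c
  have hw : Continuous fun z => ∫ y in l..z, k y :=
    intervalIntegral.continuous_primitive (fun a b => hk.intervalIntegrable a b) l
  have hφD : Differentiable ℝ φ := fun x => (hφd x).differentiableAt
  have hφc : Continuous φ := hφD.continuous
  have hφ' : deriv φ = fun x => (∫ y in l..x, k y) / P x := funext fun x => (hφd x).deriv
  have hφ'c : Continuous (deriv φ) := by
    rw [hφ']; exact hw.div hP fun x => (hP0 x).ne'
  set K := ∫ x in l..r, (W x * φ x) * |u x| ^ (p - 1) with hK
  set B := (∫ x in l..r, (-k x + μ * (W x * φ x)) * u x) with hB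
  have hKlim : Filter.Tendsto (fun j => ∫ x in l..r, (W x * φ x) * |g (σ j) x| ^ (p - 1))
      Filter.atTop (nhds K) :=
    tendsto_intervalIntegral_comp hlr.le hgc (fun k => hgC _) hlim hcpow1 (hW.mul hφc)
  have hBlim : Filter.Tendsto (fun j => ∫ x in l..r, (-k x + μ * (W x * φ x)) * g (σ j) x)
      Filter.atTop (nhds B) :=
    tendsto_intervalIntegral_comp (Φ := id) hlr.le hgc (fun k => hgC _) hlim continuous_id
      (by fun_prop)
  have hBeq : ∀ f, FiniteEnergy l r f →
      ∫ x in l..r, (P x * deriv φ x * deriv f x + μ * (W x * f x * φ x))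
        = ∫ x in l..r, (-k x + μ * (W x * φ x)) * f x := by
    intro f hf
    have hfc := hf.1.continuous
    have e1 : ∀ x, P x * deriv φ x = ∫ y in l..x, k y := by
      intro x
      have := (hP0 x).ne'
      rw [hφ']
      field_simp
    simp only [e1]
    rw [intervalIntegral.integral_add (hf.intervalIntegrable_deriv.continuousOn_mul hw.continuousOn)
      (Continuous.intervalIntegrable (by fun_prop) _ _), hf.integral_mul_deriv hk hk0,
      ← intervalIntegral.integral_neg, ← intervalIntegral.integral_add
      (Continuous.intervalIntegrable (by fun_prop) _ _)
      (Continuous.intervalIntegrable (by fun_prop) _ _)]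
    congr 1
    ext x
    ring
  have hconv : ∀ j t, 1 + p * t * (∫ x in l..r, (W x * φ x) * |g j x| ^ (p - 1))
      ≤ I (fun x => g j x + t * φ x) := by
    intro j t
    have hc := (hgF j).1.continuous
    have hc1 : Continuous fun x => |g j x| ^ (p - 1) := hcpow1.comp hc
    have i1 := (hcI _ hc).intervalIntegrable (μ := volume) l r
    have i2 : IntervalIntegrable (fun x => p * t * ((W x * φ x) * |g j x| ^ (p - 1))) volume l r :=
      Continuous.intervalIntegrable (by fun_prop) _ _
    calc _ ≤ I (g j) + p * t * (∫ x in l..r, (W x * φ x) * |g j x| ^ (p - 1)) := by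
          linarith [hg1 j]
      _ = ∫ x in l..r, (W x * |g j x| ^ p + p * t * ((W x * φ x) * |g j x| ^ (p - 1))) := by
          rw [intervalIntegral.integral_add i1 i2, intervalIntegral.integral_const_mul]
      _ ≤ _ := by
          refine intervalIntegral.integral_mono_on hlr.le (i1.add i2)
            ((hcI _ (hc.add (hφc.const_mul t))).intervalIntegrable _ _) fun x _ => ?_
          have h1 := mul_le_mul_of_nonneg_left
            (rpow_add_mul_le_abs_rpow (p := p) (by linarith) (hg0 j x) (t * φ x)) (hW0 x).le
          rw [abs_of_nonneg (hg0 j x)]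
          linarith
  have hBK : B = m * K := by
    refine eq_of_forall_rpow_le (D := Q φ) hp0 fun t ht => ?_
    have hKt : Filter.Tendsto
        (fun j => 1 + p * t * ∫ x in l..r, (W x * φ x) * |g (σ j) x| ^ (p - 1))
        Filter.atTop (nhds (1 + p * t * K)) := (hKlim.const_mul _).const_add _
    refine le_of_tendsto_of_tendsto
      ((hKt.rpow_const (Or.inl ht.ne')).const_mul m)
      ((hQlim'.add (hBlim.const_mul (2 * t))).add_const (t ^ 2 * Q φ)) ?_
    filter_upwards [hKt.eventually_const_lt ht] with j hj
    have h1 := hmin _ ((hgF (σ j)).add_smul hφD hφ'c t)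
    rw [hQ, (hgF (σ j)).weightedEnergy_add_smul hP hW hφD hφ'c, hBeq _ (hgF _)] at h1
    refine le_trans ?_ h1
    have := hconv (σ j) t
    gcongr
  have e : ∀ x, (μ * (W x * u x) - m * (W x * |u x| ^ (p - 1))) * φ x
      = ((-k x + μ * (W x * φ x)) * u x + k x * u x)
        - m * ((W x * φ x) * |u x| ^ (p - 1)) := fun x => by ring
  have hc1 : Continuous fun x => |u x| ^ (p - 1) := hcpow1.comp hu
  change ∫ x in l..r, (μ * (W x * u x) - m * (W x * |u x| ^ (p - 1))) * φ x = _
  simp only [e]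
  rw [intervalIntegral.integral_sub, intervalIntegral.integral_add,
    intervalIntegral.integral_const_mul]
  · change B + _ - m * K = _
    rw [hBK]; ring
  all_goals exact Continuous.intervalIntegrable (by fun_prop) _ _

end

lemma eqOn_zero_of_abs_deriv_le {l r x₀ K : ℝ} {E E' : ℝ → ℝ}
    (hE : ∀ x ∈ Set.Icc l r, HasDerivAt E (E' x) x) (hE0 : ∀ x ∈ Set.Icc l r, 0 ≤ E x)
    (hK : ∀ x ∈ Set.Icc l r, |E' x| ≤ K * E x) (hx₀ : x₀ ∈ Set.Icc l r) (h0 : E x₀ = 0) :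
    ∀ x ∈ Set.Icc l r, E x = 0 := by
  have hd : ∀ c : ℝ, ∀ x ∈ Set.Icc l r, HasDerivAt (fun x => exp (c * x) * E x)
      (exp (c * x) * (c * E x + E' x)) x := by
    intro c x hx
    refine ((((hasDerivAt_id x).const_mul c).exp).mul (hE x hx)).congr_deriv ?_
    simp only [id, mul_one]
    ring
  intro x hx
  refine le_antisymm ?_ (hE0 x hx)
  rcases le_total x x₀ with h | h
  · have hmono : MonotoneOn (fun x => exp (K * x) * E x) (Set.Icc l r) := by
      apply monotoneOn_of_deriv_nonneg (convex_Icc _ _)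
      · exact fun x hx => (hd K x hx).continuousAt.continuousWithinAt
      · exact fun x hx => (hd K x (interior_subset hx)).differentiableAt.differentiableWithinAt
      · intro x hx
        have hx := interior_subset hx
        rw [(hd K x hx).deriv]
        exact mul_nonneg (exp_pos _).le (by linarith [(abs_le.1 (hK x hx)).1])
    have := hmono hx hx₀ h
    simp only [h0, mul_zero] at this
    exact nonpos_of_mul_nonpos_right this (exp_pos _)
  · have hmono : AntitoneOn (fun x => exp (-K * x) * E x) (Set.Icc l r) := by
      apply antitoneOn_of_deriv_nonpos (convex_Icc _ _)
      · exact fun x hx => (hd (-K) x hx).continuousAt.continuousWithinAt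
      · exact fun x hx => (hd (-K) x (interior_subset hx)).differentiableAt.differentiableWithinAt
      · intro x hx
        have hx := interior_subset hx
        rw [(hd (-K) x hx).deriv]
        exact mul_nonpos_of_nonneg_of_nonpos (exp_pos _).le
          (by linarith [(abs_le.1 (hK x hx)).2])
    have := hmono hx₀ hx h
    simp only [h0, mul_zero] at this
    exact nonpos_of_mul_nonpos_right this (exp_pos _)

section
variable {l r μ p : ℝ} {P W : ℝ → ℝ}

/-- A weak solution of `(P u')' = h` with Neumann boundary conditions is a classical one. -/
lemma classical_of_weak (hlr : l < r) (hP : Continuous P) (hP0 : ∀ x, 0 < P x)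
    {u h : ℝ → ℝ} (hu : Continuous u) (hh : Continuous h)
    (hweak : ∀ (k : ℝ → ℝ) (c : ℝ), Continuous k → ∫ x in l..r, k x = 0 →
      (∫ x in l..r, h x * (c + ∫ z in l..x, (∫ y in l..z, k y) / P z))
        = ∫ x in l..r, k x * u x) :
    ∃ U V : ℝ → ℝ, (∀ x, HasDerivAt U (V x / P x) x) ∧ (∀ x, HasDerivAt V (h x) x) ∧
      V l = 0 ∧ V r = 0 ∧ ∀ x ∈ Set.Icc l r, U x = u x := by
  have hh0 : ∫ x in l..r, h x = 0 := by
    simpa using hweak (fun _ => 0) 1 continuous_const (by simp)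
  set F : ℝ → ℝ := fun x => 0 + ∫ z in l..x, (∫ y in l..z, h y) / P z with hF
  have hFd := hasDerivAt_testFunction (l := l) hP hP0 hh 0
  have hFc : Continuous F := continuous_iff_continuousAt.2 fun x => (hFd x).continuousAt
  have hd : Continuous fun x => u x - F x := hu.sub hFc
  set c₀ := (∫ x in l..r, (u x - F x)) / (r - l) with hc₀
  have hrl : r - l ≠ 0 := (sub_pos.2 hlr).ne'
  set k : ℝ → ℝ := fun x => u x - F x - c₀ with hk
  have hkc : Continuous k := hd.sub continuous_const
  have hk0 : ∫ x in l..r, k x = 0 := by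
    rw [hk, intervalIntegral.integral_sub (hd.intervalIntegrable _ _) intervalIntegrable_const,
      intervalIntegral.integral_const, smul_eq_mul, hc₀, mul_div_cancel₀ _ hrl, sub_self]
  have hφd := hasDerivAt_testFunction (l := l) hP hP0 hkc 0
  have hint : ∀ {g : ℝ → ℝ}, Continuous g → Continuous fun z => ∫ y in l..z, g y := fun hg =>
    intervalIntegral.continuous_primitive (fun a b => hg.intervalIntegrable a b) l
  have hdivc : ∀ {g : ℝ → ℝ}, Continuous g → Continuous fun z => (∫ y in l..z, g y) / P z :=
    fun hg => (hint hg).div hP fun x => (hP0 x).ne'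
  have e1 : ∫ x in l..r, k x * u x = ∫ x in l..r, k x * F x := by
    rw [← hweak k 0 hkc hk0]
    have a1 := intervalIntegral.integral_deriv_mul_eq_sub
      (u := fun x => ∫ y in l..x, h y) (a := l) (b := r)
      (fun x _ => (hh.integral_hasStrictDerivAt l x).hasDerivAt) (fun x _ => hφd x)
      (hh.intervalIntegrable _ _) ((hdivc hkc).intervalIntegrable _ _)
    have a2 := intervalIntegral.integral_deriv_mul_eq_sub
      (u := fun x => ∫ y in l..x, k y) (a := l) (b := r)
      (fun x _ => (hkc.integral_hasStrictDerivAt l x).hasDerivAt) (fun x _ => hFd x)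
      (hkc.intervalIntegrable _ _) ((hdivc hh).intervalIntegrable _ _)
    have hφc : Continuous fun x => 0 + ∫ z in l..x, (∫ y in l..z, k y) / P z :=
      continuous_iff_continuousAt.2 fun x => (hφd x).continuousAt
    rw [intervalIntegral.integral_add ((hh.fun_mul hφc).intervalIntegrable _ _)
      (((hint hh).fun_mul (hdivc hkc)).intervalIntegrable _ _), hh0] at a1
    rw [intervalIntegral.integral_add ((hkc.fun_mul hFc).intervalIntegrable _ _)
      (((hint hkc).fun_mul (hdivc hh)).intervalIntegrable _ _), hk0] at a2
    have a3 : ∫ x in l..r, (∫ y in l..x, h y) * ((∫ y in l..x, k y) / P x)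
        = ∫ x in l..r, (∫ y in l..x, k y) * ((∫ y in l..x, h y) / P x) := by
      congr 1
      ext x
      ring
    simp only [intervalIntegral.integral_same, zero_mul, sub_self] at a1 a2
    linarith
  have e2 : ∫ x in l..r, k x ^ 2 = 0 := by
    have : ∀ x, k x ^ 2 = k x * u x - k x * F x - c₀ * k x := fun x => by
      simp only [hk]; ring
    simp only [this]
    rw [intervalIntegral.integral_sub (Continuous.intervalIntegrable (by fun_prop) _ _)
      (Continuous.intervalIntegrable (by fun_prop) _ _),
      intervalIntegral.integral_sub (Continuous.intervalIntegrable (by fun_prop) _ _)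
      (Continuous.intervalIntegrable (by fun_prop) _ _),
      intervalIntegral.integral_const_mul, hk0, e1]
    simp
  refine ⟨fun x => c₀ + F x, fun x => ∫ y in l..x, h y, fun x => (hFd x).const_add c₀,
    fun x => (hh.integral_hasStrictDerivAt l x).hasDerivAt, by simp, hh0, fun x hx => ?_⟩
  by_contra hne
  have hkx : k x ≠ 0 := by
    intro h0
    simp only [hk] at h0
    exact hne (by linarith)
  have := intervalIntegral.integral_pos hlr (hkc.fun_pow 2).continuousOn (fun _ _ => sq_nonneg _)
    ⟨x, hx, by positivity⟩
  exact this.ne' e2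

/-- Strong maximum principle for nonnegative solutions of the Neumann problem. -/
lemma neumann_solution_pos (hP : Continuous P) (hW : Continuous W)
    (hP0 : ∀ x, 0 < P x) (hp : 2 < p) {m : ℝ} {U V : ℝ → ℝ}
    (hU : ∀ x ∈ Set.Icc l r, HasDerivAt U (V x / P x) x)
    (hV : ∀ x ∈ Set.Icc l r, HasDerivAt V (W x * (μ * U x - m * U x ^ (p - 1))) x)
    (hVl : V l = 0) (hVr : V r = 0) (hU0 : ∀ x ∈ Set.Icc l r, 0 ≤ U x)
    (hne : ∃ x ∈ Set.Icc l r, U x ≠ 0) : ∀ x ∈ Set.Icc l r, 0 < U x := by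
  intro x₀ hx₀
  by_contra hcon
  have hUx : U x₀ = 0 := le_antisymm (not_lt.1 hcon) (hU0 x₀ hx₀)
  have hVx : V x₀ = 0 := by
    rcases hx₀.1.eq_or_lt with h | h
    · rwa [← h]
    rcases hx₀.2.eq_or_lt with h' | h'
    · rwa [h']
    have hmin : IsLocalMin U x₀ := by
      filter_upwards [Icc_mem_nhds h h'] with z hz
      rw [hUx]; exact hU0 z hz
    have := hmin.hasDerivAt_eq_zero (hU x₀ hx₀)
    simpa [(hP0 x₀).ne'] using this
  have hUc : ContinuousOn U (Set.Icc l r) := fun x hx => (hU x hx).continuousAt.continuousWithinAt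
  obtain ⟨K, hK⟩ := isCompact_Icc.exists_bound_of_continuousOn (s := Set.Icc l r)
    (f := fun x => 1 / P x + W x * (μ - m * U x ^ (p - 2)))
    ((continuousOn_const.div hP.continuousOn fun x _ => (hP0 x).ne').add
      (hW.continuousOn.mul (continuousOn_const.sub (continuousOn_const.mul
        (hUc.rpow_const fun x _ => Or.inr (by linarith))))))
  have hE := eqOn_zero_of_abs_deriv_le (l := l) (r := r) (x₀ := x₀) (K := K)
    (E := fun x => U x ^ 2 + V x ^ 2)
    (E' := fun x => 2 * (U x * V x) * (1 / P x + W x * (μ - m * U x ^ (p - 2))))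
    (fun x hx => by
      refine (((hU x hx).pow 2).add ((hV x hx).pow 2)).congr_deriv ?_
      have h1 : U x ^ (p - 1) = U x ^ (p - 2) * U x := by
        rcases (hU0 x hx).eq_or_lt with h | h
        · rw [← h, zero_rpow (by linarith)]; simp
        · rw [← rpow_add_one h.ne']; congr 1; ring
      rw [h1]
      simp only [Nat.cast_ofNat, Nat.add_one_sub_one, pow_one]
      ring)
    (fun x _ => by positivity)
    (fun x hx => by
      have h1 := hK x hx
      rw [norm_eq_abs] at h1
      have h2 : |2 * (U x * V x)| ≤ U x ^ 2 + V x ^ 2 := by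
        rw [abs_le]
        constructor <;> nlinarith [sq_nonneg (U x + V x), sq_nonneg (U x - V x)]
      rw [abs_mul, mul_comm K]
      exact mul_le_mul h2 h1 (abs_nonneg _) (by positivity))
    hx₀ (by simp [hUx, hVx])
  obtain ⟨x, hx, hxne⟩ := hne
  have := hE x hx
  have h3 : 0 < U x ^ 2 := by positivity
  nlinarith [sq_nonneg (V x)]

/-- The best constant in the weighted inequality is attained by a positive classical solution of
the Euler–Lagrange equation. -/
lemma exists_classical_minimizer (hlr : l < r) (hP : Continuous P) (hW : Continuous W)
    (hP0 : ∀ x, 0 < P x) (hW0 : ∀ x, 0 < W x) (hμ : 0 < μ) (hp : 2 < p) :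
    ∃ (m : ℝ) (U V : ℝ → ℝ),
      (∀ f, FiniteEnergy l r f →
        m * (∫ x in l..r, W x * |f x| ^ p) ^ (2 / p) ≤ weightedEnergy P W μ l r f) ∧
      m * (∫ x in l..r, W x * |U x| ^ p) ^ (2 / p) ≤ m ∧
      (∀ x ∈ Set.Icc l r, HasDerivAt U (V x / P x) x) ∧
      (∀ x ∈ Set.Icc l r, HasDerivAt V (W x * (μ * U x - m * U x ^ (p - 1))) x) ∧
      V l = 0 ∧ V r = 0 ∧ ∀ x ∈ Set.Icc l r, 0 < U x := by
  obtain ⟨m, u, hu, hu0, hmin, hI, hm, hweak⟩ :=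
    exists_weak_minimizer hlr hP hW hP0 hW0 hμ hp
  have hcpow1 : Continuous fun x => |u x| ^ (p - 1) :=
    hu.abs.rpow_const fun _ => Or.inr (by linarith)
  obtain ⟨U, V, hU, hV, hVl, hVr, hUu⟩ := classical_of_weak hlr hP hP0 hu (by fun_prop) hweak
  have hV' : ∀ x ∈ Set.Icc l r, HasDerivAt V (W x * (μ * U x - m * U x ^ (p - 1))) x := by
    intro x hx
    refine (hV x).congr_deriv ?_
    rw [hUu x hx, abs_of_nonneg (hu0 x hx)]
    ring
  have hIU : ∫ x in l..r, W x * |U x| ^ p = ∫ x in l..r, W x * |u x| ^ p := by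
    refine intervalIntegral.integral_congr fun x hx => ?_
    rw [Set.uIcc_of_le hlr.le] at hx
    simp only [hUu x hx]
  refine ⟨m, U, V, hmin, hIU ▸ hm, fun x _ => hU x, hV', hVl, hVr, ?_⟩
  refine neumann_solution_pos hP hW hP0 hp (fun x _ => hU x) hV' hVl hVr
    (fun x hx => (hUu x hx).symm ▸ hu0 x hx) ?_
  by_contra! hcon
  have : ∫ x in l..r, W x * |U x| ^ p = 0 := by
    rw [← intervalIntegral.integral_zero (a := l) (b := r) (μ := volume)]
    refine intervalIntegral.integral_congr fun x hx => ?_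
    rw [Set.uIcc_of_le hlr.le] at hx
    simp only [hcon x hx, abs_zero]
    rw [zero_rpow (by linarith), mul_zero]
  rw [hIU] at this
  linarith

end

lemma ultraspherical_truncated {n p a μ : ℝ} (hn : 0 < n) (hp : 2 < p)
    (hp' : 2 < n → p ≤ 2 * n / (n - 2)) (ha0 : 0 < a) (ha1 : a < 1) (hμ0 : 0 < μ)
    (hμ : μ * (p - 2) < n) {f : ℝ → ℝ} (hf : FiniteEnergy (-a) a f) :
    μ * ((∫ x in (-a)..a, (1 - x ^ 2) ^ ((n - 2) / 2)) ^ (1 - 2 / p) *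
      (∫ x in (-a)..a, (1 - x ^ 2) ^ ((n - 2) / 2) * |f x| ^ p) ^ (2 / p))
      ≤ (∫ x in (-a)..a, (1 - x ^ 2) ^ (n / 2) * deriv f x ^ 2) +
        μ * ∫ x in (-a)..a, (1 - x ^ 2) ^ ((n - 2) / 2) * f x ^ 2 := by
  have ha2 : 0 < 1 - a ^ 2 := by nlinarith
  have hlr : -a < a := by linarith
  have hmax : ∀ x, 0 < max (1 - x ^ 2) (1 - a ^ 2) := fun x => lt_max_of_lt_right ha2
  have hmaxeq : ∀ x ∈ Set.Icc (-a) a, max (1 - x ^ 2) (1 - a ^ 2) = 1 - x ^ 2 := fun x hx =>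
    max_eq_left (by nlinarith [hx.1, hx.2])
  have hcont : ∀ s : ℝ, Continuous fun x : ℝ => max (1 - x ^ 2) (1 - a ^ 2) ^ s := fun s =>
    Continuous.rpow_const (by fun_prop) fun x => Or.inl (hmax x).ne'
  have hposw : ∀ s : ℝ, ∀ x : ℝ, 0 < max (1 - x ^ 2) (1 - a ^ 2) ^ s := fun s x =>
    rpow_pos_of_pos (hmax x) s
  have hcongr : ∀ (s : ℝ) (g : ℝ → ℝ), ∫ x in (-a)..a, (1 - x ^ 2) ^ s * g x =
      ∫ x in (-a)..a, max (1 - x ^ 2) (1 - a ^ 2) ^ s * g x := fun s g =>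
    intervalIntegral.integral_congr fun x hx => by
      rw [Set.uIcc_of_le hlr.le] at hx
      simp only [hmaxeq x hx]
  have hcongr1 : ∀ s : ℝ, ∫ x in (-a)..a, (1 - x ^ 2) ^ s =
      ∫ x in (-a)..a, max (1 - x ^ 2) (1 - a ^ 2) ^ s := fun s => by
    simpa using hcongr s fun _ => 1
  obtain ⟨m, U, V, hmin, hm, hU, hV, hl, hr, hpos⟩ := exists_classical_minimizer hlr
    (hcont (n / 2)) (hcont ((n - 2) / 2)) (hposw _) (hposw _) hμ0 hp
  have hU' : ∀ x ∈ Set.Icc (-a) a, HasDerivAt U (V x / (1 - x ^ 2) ^ (n / 2)) x :=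
    fun x hx => by simpa only [hmaxeq x hx] using hU x hx
  have hV' : ∀ x ∈ Set.Icc (-a) a, HasDerivAt V
      ((1 - x ^ 2) ^ ((n - 2) / 2) * (μ * U x - m * U x ^ (p - 1))) x :=
    fun x hx => by simpa only [hmaxeq x hx] using hV x hx
  have hV0 := ultraspherical_rigidity hn hp hp' ha1 hμ hU' hV' hl hr hpos
  have hV0' : ∀ x ∈ Set.Icc (-a) a, V x = 0 := by
    intro x hx
    rcases eq_or_lt_of_le hx.1 with h | h
    · rw [← h, hl]
    rcases eq_or_lt_of_le hx.2 with h' | h'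
    · rw [h', hr]
    exact hV0 x ⟨h, h'⟩
  have h0 : (0 : ℝ) ∈ Set.Icc (-a) a := ⟨by linarith, ha0.le⟩
  have hUc : ∀ x ∈ Set.Icc (-a) a, U x = U 0 := by
    intro x hx
    refine (convex_Icc (-a) a).is_const_of_fderivWithin_eq_zero (𝕜 := ℝ)
      (fun y hy => (hU' y hy).differentiableAt.differentiableWithinAt) (fun y hy => ?_) hx h0
    have hd : HasDerivAt U 0 y := (hU' y hy).congr_deriv (by rw [hV0' y hy, zero_div])
    rw [hd.hasFDerivAt.hasFDerivWithinAt.fderivWithin (uniqueDiffOn_Icc hlr y hy)]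
    ext
    simp
  set c := U 0 with hc
  have hc0 : 0 < c := hpos 0 h0
  have heq : μ * c = m * c ^ (p - 1) := by
    have h1 : HasDerivAt V 0 0 := (hasDerivAt_const (0 : ℝ) (0 : ℝ)).congr_of_eventuallyEq <|
      Filter.eventuallyEq_of_mem (Ioo_mem_nhds (by linarith) ha0) hV0
    have h2 := h1.unique (hV' 0 h0)
    simp at h2
    linarith
  have hm' : m = μ * c ^ (2 - p) := by
    have h1 : c ^ (p - 1) * c ^ (2 - p) = c := by
      rw [← rpow_add hc0]; norm_num
    have h2 : 0 < c ^ (p - 1) := rpow_pos_of_pos hc0 _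
    apply mul_right_cancel₀ h2.ne'
    rw [← heq, mul_assoc, mul_comm (c ^ (2 - p)), h1]
  have hm0 : 0 < m := hm' ▸ mul_pos hμ0 (rpow_pos_of_pos hc0 _)
  set M := ∫ x in (-a)..a, (1 - x ^ 2) ^ ((n - 2) / 2) with hM
  have hM0 : 0 < M := by
    rw [hM, hcongr1]
    exact intervalIntegral.intervalIntegral_pos_of_pos_on ((hcont _).intervalIntegrable _ _)
      (fun x _ => hposw _ x) hlr
  have hnorm : c ^ p * M ≤ 1 := by
    have h1 : ∫ x in (-a)..a, max (1 - x ^ 2) (1 - a ^ 2) ^ ((n - 2) / 2) * |U x| ^ p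
        = c ^ p * M := by
      rw [hM, hcongr1, mul_comm, ← intervalIntegral.integral_mul_const]
      refine intervalIntegral.integral_congr fun x hx => ?_
      rw [Set.uIcc_of_le hlr.le] at hx
      simp only [hUc x hx, abs_of_pos hc0]
    rw [h1] at hm
    by_contra! hlt
    have h2 : 1 < (c ^ p * M) ^ (2 / p) := one_lt_rpow hlt (by positivity)
    nlinarith
  have hMm : μ * M ^ (1 - 2 / p) ≤ m := by
    rw [hm']
    refine mul_le_mul_of_nonneg_left ?_ hμ0.le
    have h1 : M ≤ c ^ (-p) := by
      rw [rpow_neg hc0.le, ← one_div, le_div_iff₀ (rpow_pos_of_pos hc0 _)]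
      linarith
    have h2 : 0 ≤ 1 - 2 / p := by
      rw [sub_nonneg, div_le_one (by linarith)]; exact hp.le
    calc M ^ (1 - 2 / p) ≤ (c ^ (-p)) ^ (1 - 2 / p) := rpow_le_rpow hM0.le h1 h2
      _ = c ^ (2 - p) := by
        rw [← rpow_mul hc0.le]
        congr 1
        field_simp
        ring
  have hfin := hmin f hf
  have hsplit : weightedEnergy (fun x => max (1 - x ^ 2) (1 - a ^ 2) ^ (n / 2))
      (fun x => max (1 - x ^ 2) (1 - a ^ 2) ^ ((n - 2) / 2)) μ (-a) a f =
      (∫ x in (-a)..a, (1 - x ^ 2) ^ (n / 2) * deriv f x ^ 2) +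
        μ * ∫ x in (-a)..a, (1 - x ^ 2) ^ ((n - 2) / 2) * f x ^ 2 := by
    rw [hcongr, hcongr, weightedEnergy, ← intervalIntegral.integral_const_mul,
      intervalIntegral.integral_add]
    · exact hf.2.continuousOn_mul (hcont _).continuousOn
    · exact (((hcont _).mul (hf.1.continuous.pow 2)).const_mul μ).intervalIntegrable _ _
  rw [← hsplit, hcongr ((n - 2) / 2)]
  refine le_trans ?_ hfin
  rw [← mul_assoc]
  exact mul_le_mul_of_nonneg_right hMm (rpow_nonneg (intervalIntegral.integral_nonneg hlr.le
    fun x _ => mul_nonneg (hposw _ x).le (rpow_nonneg (abs_nonneg _) _)) _)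

lemma integral_one_sub_sq_rpow {n : ℝ} (hn : 0 < n) :
    ∫ z in (-1 : ℝ)..1, (1 - z ^ 2) ^ ((n - 2) / 2) =
      √π * Gamma (n / 2) / Gamma ((n + 1) / 2) := by
  have hn2 : 0 < n / 2 := by positivity
  have hre : ∀ x ∈ Set.uIcc (0 : ℝ) 1, ((x : ℂ) ^ (((n / 2 : ℝ) : ℂ) - 1) *
      (1 - (x : ℂ)) ^ (((n / 2 : ℝ) : ℂ) - 1)) =
      ((x ^ (n / 2 - 1) * (1 - x) ^ (n / 2 - 1) : ℝ) : ℂ) := by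
    intro x hx
    rw [Set.uIcc_of_le zero_le_one] at hx
    push_cast [Complex.ofReal_cpow hx.1, Complex.ofReal_cpow (sub_nonneg.2 hx.2)]
    rfl
  have hval : ∫ x in (0 : ℝ)..1, x ^ (n / 2 - 1) * (1 - x) ^ (n / 2 - 1) =
      Gamma (n / 2) * Gamma (n / 2) / Gamma n := by
    have h := ProbabilityTheory.beta_eq_betaIntegralReal (n / 2) (n / 2) hn2 hn2
    rw [Complex.betaIntegral, intervalIntegral.integral_congr hre,
      intervalIntegral.integral_ofReal, Complex.ofReal_re, ProbabilityTheory.beta,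
      add_halves] at h
    exact h.symm
  have hsub : ∀ x ∈ Set.uIcc (0 : ℝ) 1, (1 - (2 * x - 1) ^ 2) ^ ((n - 2) / 2) =
      4 ^ (n / 2 - 1) * (x ^ (n / 2 - 1) * (1 - x) ^ (n / 2 - 1)) := by
    intro x hx
    rw [Set.uIcc_of_le zero_le_one] at hx
    have h1 : 0 ≤ 1 - x := sub_nonneg.2 hx.2
    rw [← mul_rpow hx.1 h1, ← mul_rpow (by norm_num) (mul_nonneg hx.1 h1)]
    congr 1 <;> ring
  have h := intervalIntegral.integral_comp_mul_sub (a := 0) (b := 1)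
    (fun z : ℝ => (1 - z ^ 2) ^ ((n - 2) / 2)) (two_ne_zero) (1 : ℝ)
  rw [intervalIntegral.integral_congr hsub, intervalIntegral.integral_const_mul, hval] at h
  norm_num at h
  have hd := Gamma_mul_Gamma_add_half (n / 2)
  have h4 : (4 : ℝ) ^ (n / 2 - 1) * 2 * 2 ^ (1 - n) = 1 := by
    rw [show (4 : ℝ) = 2 ^ (2 : ℝ) by norm_num, ← rpow_mul zero_le_two,
      ← rpow_add_one two_ne_zero, ← rpow_add two_pos]
    ring_nf
    exact rpow_zero _
  rw [show 2 * (n / 2) = n by ring, show n / 2 + 1 / 2 = (n + 1) / 2 by ring] at hd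
  have g1 : 0 < Gamma n := Gamma_pos_of_pos hn
  have g2 : 0 < Gamma ((n + 1) / 2) := Gamma_pos_of_pos (by positivity)
  rw [eq_div_iff g2.ne']
  have h5 : ∫ z in (-1 : ℝ)..1, (1 - z ^ 2) ^ ((n - 2) / 2) =
      2 * (4 ^ (n / 2 - 1) * (Gamma (n / 2) * Gamma (n / 2) / Gamma n)) := by linarith
  rw [h5]
  calc 2 * (4 ^ (n / 2 - 1) * (Gamma (n / 2) * Gamma (n / 2) / Gamma n)) * Gamma ((n + 1) / 2)
      = 2 * 4 ^ (n / 2 - 1) * Gamma (n / 2) / Gamma n *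
        (Gamma (n / 2) * Gamma ((n + 1) / 2)) := by ring
    _ = (4 ^ (n / 2 - 1) * 2 * 2 ^ (1 - n)) * (√π * Gamma (n / 2)) := by
      rw [hd]; field_simp
    _ = √π * Gamma (n / 2) := by rw [h4, one_mul]

lemma tendsto_integral_symmetric_interval {g : ℝ → ℝ} (hg : IntervalIntegrable g volume (-1) 1) :
    Filter.Tendsto (fun a : ℝ => ∫ x in (-a)..a, g x) (nhdsWithin 1 (Set.Iio 1))
      (nhds (∫ x in (-1 : ℝ)..1, g x)) := by
  have h1 : Filter.Tendsto (fun a : ℝ => a) (nhdsWithin 1 (Set.Iio 1)) (nhds 1) :=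
    tendsto_nhdsWithin_of_tendsto_nhds Filter.tendsto_id
  have hcov := aecover_Ioc_of_Ioc (μ := (volume : Measure ℝ)) h1.neg h1
  have hlim := hcov.integral_tendsto_of_countably_generated (f := g)
    ((intervalIntegrable_iff_integrableOn_Ioc_of_le (by norm_num)).1 hg)
  rw [← intervalIntegral.integral_of_le (by norm_num)] at hlim
  refine hlim.congr' ?_
  filter_upwards [self_mem_nhdsWithin, Ioo_mem_nhdsLT (zero_lt_one' ℝ)] with a _ ha
  rw [Measure.restrict_restrict measurableSet_Ioc, Set.inter_eq_left.2
    (Set.Ioc_subset_Ioc (by linarith [ha.2]) ha.2.le),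
    intervalIntegral.integral_of_le (by linarith [ha.1])]

lemma finiteEnergy_of_intervalIntegrable {n a : ℝ} (ha0 : 0 < a) (ha1 : a < 1)
    {f : ℝ → ℝ} (hf : Differentiable ℝ f)
    (hf' : IntervalIntegrable (fun x => (1 - x ^ 2) ^ (n / 2) * deriv f x ^ 2) volume (-1) 1) :
    FiniteEnergy (-a) a f := by
  refine ⟨hf, ?_⟩
  have hsub : IntervalIntegrable (fun x => (1 - x ^ 2) ^ (n / 2) * deriv f x ^ 2) volume (-a) a := by
    refine hf'.mono_set ?_
    rw [Set.uIcc_of_le (by linarith), Set.uIcc_of_le (by linarith)]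
    exact Set.Icc_subset_Icc (by linarith) ha1.le
  have hpos : ∀ x ∈ Set.Icc (-a) a, 0 < 1 - x ^ 2 := fun x hx => by nlinarith [hx.1, hx.2]
  have hcont : ContinuousOn (fun x : ℝ => (1 - x ^ 2) ^ (-(n / 2))) (Set.uIcc (-a) a) := by
    rw [Set.uIcc_of_le (by linarith)]
    exact ContinuousOn.rpow_const (by fun_prop) fun x hx => Or.inl (hpos x hx).ne'
  refine (hsub.continuousOn_mul hcont).congr fun x hx => ?_
  rw [Set.uIoc_of_le (by linarith)] at hx
  have hx' := hpos x (Set.Ioc_subset_Icc_self hx)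
  rw [← mul_assoc, ← rpow_add hx', neg_add_cancel, rpow_zero, one_mul]

lemma ultraspherical_interpolation {n p : ℝ} (hn : 0 < n) (hp : 2 < p)
    (hp' : 2 < n → p ≤ 2 * n / (n - 2)) {f : ℝ → ℝ} (hf : Differentiable ℝ f)
    (hw : IntervalIntegrable (fun x : ℝ => (1 - x ^ 2) ^ ((n - 2) / 2)) volume (-1) 1)
    (hw0 : ∫ x in (-1 : ℝ)..1, (1 - x ^ 2) ^ ((n - 2) / 2) ≠ 0)
    (hf2 : IntervalIntegrable (fun x => (1 - x ^ 2) ^ ((n - 2) / 2) * f x ^ 2) volume (-1) 1)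
    (hfp : IntervalIntegrable (fun x => (1 - x ^ 2) ^ ((n - 2) / 2) * |f x| ^ p) volume (-1) 1)
    (hf' : IntervalIntegrable (fun x => (1 - x ^ 2) ^ (n / 2) * deriv f x ^ 2) volume (-1) 1) :
    n / (p - 2) * ((∫ x in (-1 : ℝ)..1, (1 - x ^ 2) ^ ((n - 2) / 2)) ^ (1 - 2 / p) *
      (∫ x in (-1 : ℝ)..1, (1 - x ^ 2) ^ ((n - 2) / 2) * |f x| ^ p) ^ (2 / p))
      ≤ (∫ x in (-1 : ℝ)..1, (1 - x ^ 2) ^ (n / 2) * deriv f x ^ 2) +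
        n / (p - 2) * ∫ x in (-1 : ℝ)..1, (1 - x ^ 2) ^ ((n - 2) / 2) * f x ^ 2 := by
  have hμ0 : 0 < n / (p - 2) := div_pos hn (by linarith)
  have key : ∀ μ ∈ Set.Ioo 0 (n / (p - 2)),
      μ * ((∫ x in (-1 : ℝ)..1, (1 - x ^ 2) ^ ((n - 2) / 2)) ^ (1 - 2 / p) *
      (∫ x in (-1 : ℝ)..1, (1 - x ^ 2) ^ ((n - 2) / 2) * |f x| ^ p) ^ (2 / p))
      ≤ (∫ x in (-1 : ℝ)..1, (1 - x ^ 2) ^ (n / 2) * deriv f x ^ 2) +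
        μ * ∫ x in (-1 : ℝ)..1, (1 - x ^ 2) ^ ((n - 2) / 2) * f x ^ 2 := by
    intro μ hμ
    refine le_of_tendsto_of_tendsto
      ((((tendsto_integral_symmetric_interval hw).rpow_const (Or.inl hw0)).mul
        ((tendsto_integral_symmetric_interval hfp).rpow_const
          (Or.inr (by positivity)))).const_mul μ)
      ((tendsto_integral_symmetric_interval hf').add
        ((tendsto_integral_symmetric_interval hf2).const_mul μ)) ?_
    filter_upwards [Ioo_mem_nhdsLT (zero_lt_one' ℝ)] with a ha
    exact ultraspherical_truncated hn hp hp' ha.1 ha.2 hμ.1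
      ((lt_div_iff₀ (by linarith)).1 hμ.2)
      (finiteEnergy_of_intervalIntegrable ha.1 ha.2 hf hf')
  have hid : Filter.Tendsto (fun μ : ℝ => μ) (nhdsWithin (n / (p - 2)) (Set.Iio (n / (p - 2))))
      (nhds (n / (p - 2))) := tendsto_nhdsWithin_of_tendsto_nhds Filter.tendsto_id
  refine le_of_tendsto_of_tendsto (hid.mul_const _) ((hid.mul_const _).const_add _) ?_
  filter_upwards [Ioo_mem_nhdsLT hμ0] with μ hμ using key μ hμ

theorem stmt_8 (n p : ℝ) (hn : 0 < n) (hp : 2 < p)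
    (hp' : 2 < n → p ≤ 2 * n / (n - 2))
    (ν : Measure ℝ)
    (hν : ν = (volume.restrict (Set.Icc (-1 : ℝ) 1)).withDensity
      (fun z => ENNReal.ofReal
        ((1 - z ^ 2) ^ ((n - 2) / 2) / (Real.sqrt π * Gamma (n / 2) / Gamma ((n + 1) / 2)))))
    (f : ℝ → ℝ) (hf : Differentiable ℝ f)
    (hf2 : Integrable (fun z => (f z) ^ 2) ν)
    (hfp : Integrable (fun z => |f z| ^ p) ν)
    (hf' : Integrable (fun z => (deriv f z) ^ 2 * (1 - z ^ 2)) ν) :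
    ∫ z, (deriv f z) ^ 2 * (1 - z ^ 2) ∂ν
      ≥ n / (p - 2) * ((∫ z, |f z| ^ p ∂ν) ^ (2 / p) - ∫ z, (f z) ^ 2 ∂ν) := by
  have hmass := integral_one_sub_sq_rpow hn
  have hZ : 0 < √π * Gamma (n / 2) / Gamma ((n + 1) / 2) := by
    have := Gamma_pos_of_pos (show 0 < n / 2 by positivity)
    have := Gamma_pos_of_pos (show 0 < (n + 1) / 2 by positivity)
    positivity
  set Z := √π * Gamma (n / 2) / Gamma ((n + 1) / 2)
  have hw0 : ∫ x in (-1 : ℝ)..1, (1 - x ^ 2) ^ ((n - 2) / 2) ≠ 0 := hmass ▸ hZ.ne'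
  have hw := intervalIntegral.intervalIntegrable_of_integral_ne_zero hw0
  have hmeas : Measurable fun z : ℝ => ENNReal.ofReal ((1 - z ^ 2) ^ ((n - 2) / 2) / Z) := by
    fun_prop
  have hle : (-1 : ℝ) ≤ 1 := by norm_num
  have hdens : ∀ g : ℝ → ℝ, ∀ᵐ z ∂(volume.restrict (Set.Icc (-1 : ℝ) 1)),
      (ENNReal.ofReal ((1 - z ^ 2) ^ ((n - 2) / 2) / Z)).toReal • g z =
        Z⁻¹ * ((1 - z ^ 2) ^ ((n - 2) / 2) * g z) := fun g => by
    filter_upwards [ae_restrict_mem measurableSet_Icc] with z hz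
    have h0 : 0 ≤ 1 - z ^ 2 := by nlinarith [hz.1, hz.2]
    rw [ENNReal.toReal_ofReal (by positivity), smul_eq_mul]
    ring
  have hint : ∀ g : ℝ → ℝ, ∫ z, g z ∂ν =
      Z⁻¹ * ∫ z in (-1 : ℝ)..1, (1 - z ^ 2) ^ ((n - 2) / 2) * g z := fun g => by
    rw [hν, integral_withDensity_eq_integral_toReal_smul hmeas
      (Filter.Eventually.of_forall fun _ => ENNReal.ofReal_lt_top), integral_congr_ae (hdens g),
      integral_const_mul, integral_Icc_eq_integral_Ioc, ← intervalIntegral.integral_of_le hle]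
  have hintble : ∀ g : ℝ → ℝ, Integrable g ν →
      IntervalIntegrable (fun z => (1 - z ^ 2) ^ ((n - 2) / 2) * g z) volume (-1) 1 := by
    intro g hg
    rw [hν, integrable_withDensity_iff_integrable_smul' hmeas
      (Filter.Eventually.of_forall fun _ => ENNReal.ofReal_lt_top),
      integrable_congr (hdens g)] at hg
    rw [intervalIntegrable_iff_integrableOn_Icc_of_le hle]
    refine (hg.const_mul Z).congr (Filter.Eventually.of_forall fun z => ?_)
    simp only
    rw [mul_inv_cancel_left₀ hZ.ne']
  have hderiv : ∀ z ∈ Set.Icc (-1 : ℝ) 1,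
      (1 - z ^ 2) ^ ((n - 2) / 2) * (deriv f z ^ 2 * (1 - z ^ 2)) =
        (1 - z ^ 2) ^ (n / 2) * deriv f z ^ 2 := by
    intro z hz
    have h0 : 0 ≤ 1 - z ^ 2 := by nlinarith [hz.1, hz.2]
    have h1 : (1 - z ^ 2) ^ (n / 2) = (1 - z ^ 2) ^ ((n - 2) / 2) * (1 - z ^ 2) := by
      rw [← rpow_add_one' h0 (by linarith)]
      ring_nf
    rw [h1]
    ring
  have hd : IntervalIntegrable (fun z => (1 - z ^ 2) ^ (n / 2) * deriv f z ^ 2) volume (-1) 1 :=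
    (hintble _ hf').congr fun z hz =>
      hderiv z (Set.Ioc_subset_Icc_self (Set.uIoc_of_le hle ▸ hz))
  have hd' : ∫ z in (-1 : ℝ)..1, (1 - z ^ 2) ^ ((n - 2) / 2) * (deriv f z ^ 2 * (1 - z ^ 2)) =
      ∫ z in (-1 : ℝ)..1, (1 - z ^ 2) ^ (n / 2) * deriv f z ^ 2 :=
    intervalIntegral.integral_congr fun z hz => hderiv z (Set.uIcc_of_le hle ▸ hz)
  have h := ultraspherical_interpolation hn hp hp' hf hw hw0 (hintble _ hf2) (hintble _ hfp) hd
  rw [hmass] at h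
  have hI : 0 ≤ ∫ z in (-1 : ℝ)..1, (1 - z ^ 2) ^ ((n - 2) / 2) * |f z| ^ p :=
    intervalIntegral.integral_nonneg hle fun z hz => by
      have h0 : 0 ≤ 1 - z ^ 2 := by nlinarith [hz.1, hz.2]
      positivity
  rw [hint, hint, hint, hd', mul_rpow (inv_nonneg.2 hZ.le) hI]
  have hZp : Z⁻¹ ^ (2 / p) = Z⁻¹ * Z ^ (1 - 2 / p) := by
    rw [inv_rpow hZ.le, rpow_sub hZ, rpow_one]
    field_simp
  rw [hZp]
  have h' := mul_le_mul_of_nonneg_left h (inv_nonneg.2 hZ.le)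
  rw [ge_iff_le]
  linarith
end

section
/- Let n > 0 and ρ(z) = √(1−z²). For all f ∈ H¹([−1,1], dν_n), f ≠ 0, one has ∫ ρ²|f'|² dν_n ≥ (n/2) ∫ f² log(f²/‖f‖²₂) dν_n, where ‖f‖₂ is the L²(dν_n) norm. -/
open MeasureTheory Real

open Set Filter Topology

/-- A solution `y` of an implicit equation `F x (y x) = const` is differentiable when it is locally
the only solution. -/
theorem hasDerivAt_of_implicit_eq {F F₁ F₂ : ℝ → ℝ → ℝ} {y : ℝ → ℝ} {z : ℝ}
    (h₁ : ∀ᶠ v in 𝓝 (z, y z), HasDerivAt (F · v.2) (F₁ v.1 v.2) v.1)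
    (h₂ : ∀ᶠ v in 𝓝 (z, y z), HasDerivAt (F v.1 ·) (F₂ v.1 v.2) v.2)
    (c₁ : ContinuousAt ↿F₁ (z, y z)) (c₂ : ContinuousAt ↿F₂ (z, y z))
    (h₀ : F₂ z (y z) ≠ 0)
    (hy : ∀ᶠ x in 𝓝 z, ∀ t, F x t = F z (y z) → t = y x) :
    HasDerivAt y (-(F₁ z (y z) / F₂ z (y z))) z := by
  let T := ContinuousLinearMap.toSpanSingletonCLE (𝕜 := ℝ) (E := ℝ)
  let f₁ : ℝ → ℝ → ℝ →L[ℝ] ℝ := fun a b => T (F₁ a b)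
  let f₂ : ℝ → ℝ → ℝ →L[ℝ] ℝ := fun a b => T (F₂ a b)
  have df₁ : ∀ᶠ v in 𝓝 (z, y z), HasFDerivAt (F · v.2) (f₁ v.1 v.2) v.1 := h₁
  have df₂ : ∀ᶠ v in 𝓝 (z, y z), HasFDerivAt (F v.1 ·) (f₂ v.1 v.2) v.2 := h₂
  have cf₁ : ContinuousAt ↿f₁ (z, y z) := T.continuous.continuousAt.comp c₁
  have cf₂ : ContinuousAt ↿f₂ (z, y z) := T.continuous.continuousAt.comp c₂
  let e : ℝ ≃L[ℝ] ℝ := ContinuousLinearEquiv.unitsEquivAut ℝ (Units.mk0 _ h₀)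
  have he : (e : ℝ →L[ℝ] ℝ) = f₂ z (y z) := by
    ext; simp [e, f₂, T]
  have inv : (f₂ (z, y z).1 (z, y z).2).IsInvertible := ⟨e, he⟩
  have hψ := (hasStrictFDerivAt_implicitFunctionOfBivariate df₁ df₂ cf₁ cf₂ inv).hasFDerivAt
  have hsol := eventually_apply_implicitFunctionOfBivariate df₁ df₂ cf₁ cf₂ inv
  have heq : implicitFunctionOfBivariate df₁ df₂ cf₁ cf₂ inv =ᶠ[𝓝 z] y := by
    filter_upwards [hsol, hy] with x hx hxy using hxy _ hx
  refine (hψ.congr_of_eventuallyEq heq.symm).hasDerivAt.congr_deriv ?_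
  rw [show f₂ (z, y z).1 (z, y z).2 = (e : ℝ →L[ℝ] ℝ) from he.symm,
    ContinuousLinearMap.inverse_equiv]
  simp [e, f₁, T, div_eq_mul_inv]

/-- The exponential factor `exp (2 z η - (1 - z²) η² / (p + 1))` of the calibration. -/
noncomputable def calibKernel (p z η : ℝ) : ℝ :=
  Real.exp (2 * z * η - (1 - z ^ 2) * η ^ 2 / (p + 1))

/-- The calibration potential: its level sets define the comparison slope `y`. -/
noncomputable def calibPotential (p z y : ℝ) : ℝ :=
  (1 - z ^ 2) ^ p / p * ∫ η in (0 : ℝ)..y, calibKernel p z η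

/-- The nonnegative remainder in the derivative of `calibPotential`. -/
noncomputable def calibRemainder (p z y : ℝ) : ℝ :=
  ∫ η in (0 : ℝ)..y, η ^ 3 * calibKernel p z η

/-- The derivative of `calibPotential` with respect to its first variable, over the weight. -/
noncomputable def calibSlope (p z y : ℝ) : ℝ :=
  calibKernel p z y * (1 - (1 - z ^ 2) * y ^ 2 / (p * (p + 1))) - 1
    - 2 * (1 - z ^ 2) ^ 2 / (p * (p + 1) ^ 2) * calibRemainder p z y

theorem calibKernel_pos (p z η : ℝ) : 0 < calibKernel p z η := Real.exp_pos _

theorem continuous_calibKernel (p : ℝ) : Continuous fun v : ℝ × ℝ => calibKernel p v.1 v.2 := by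
  unfold calibKernel
  fun_prop

theorem continuous_calibKernel_right (p z : ℝ) : Continuous (calibKernel p z) := by
  unfold calibKernel
  fun_prop

theorem hasDerivAt_calibKernel_left (p z η : ℝ) :
    HasDerivAt (fun x => calibKernel p x η)
      (calibKernel p z η * (2 * η + 2 * z * η ^ 2 / (p + 1))) z := by
  have h : HasDerivAt (fun x : ℝ => 2 * x * η - (1 - x ^ 2) * η ^ 2 / (p + 1))
      (2 * 1 * η - (-(2 * z)) * η ^ 2 / (p + 1)) z := by
    refine (((hasDerivAt_id z).const_mul 2).mul_const η).sub
      (HasDerivAt.div_const (HasDerivAt.mul_const ?_ _) _)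
    simpa using (hasDerivAt_pow 2 z).const_sub 1
  exact h.exp.congr_deriv (by unfold calibKernel; ring)

theorem hasDerivAt_calibKernel_right (p z η : ℝ) :
    HasDerivAt (calibKernel p z)
      (calibKernel p z η * (2 * z - (1 - z ^ 2) * (2 * η) / (p + 1))) η := by
  have h : HasDerivAt (fun x : ℝ => 2 * z * x - (1 - z ^ 2) * x ^ 2 / (p + 1))
      (2 * z * 1 - (1 - z ^ 2) * (2 * η) / (p + 1)) η := by
    refine ((hasDerivAt_id η).const_mul (2 * z)).sub
      (HasDerivAt.div_const (HasDerivAt.const_mul _ ?_) _)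
    simpa using hasDerivAt_pow 2 η
  exact h.exp.congr_deriv (by unfold calibKernel; ring)

theorem continuous_calibRemainder (p : ℝ) :
    Continuous fun v : ℝ × ℝ => calibRemainder p v.1 v.2 := by
  unfold calibRemainder
  have h : Continuous (Function.uncurry fun (v : ℝ × ℝ) (η : ℝ) => η ^ 3 * calibKernel p v.1 η) := by
    unfold calibKernel Function.uncurry
    fun_prop
  exact intervalIntegral.continuous_parametric_intervalIntegral_of_continuous h continuous_snd

theorem continuous_calibSlope (p : ℝ) : Continuous fun v : ℝ × ℝ => calibSlope p v.1 v.2 := by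
  have h₁ := continuous_calibKernel p
  have h₂ := continuous_calibRemainder p
  unfold calibSlope
  fun_prop

theorem calibRemainder_nonneg (p z y : ℝ) : 0 ≤ calibRemainder p z y := by
  unfold calibRemainder
  rcases le_total 0 y with hy | hy
  · exact intervalIntegral.integral_nonneg hy fun η hη =>
      mul_nonneg (pow_nonneg hη.1 3) (calibKernel_pos p z η).le
  · rw [intervalIntegral.integral_symm, ← intervalIntegral.integral_neg]
    refine intervalIntegral.integral_nonneg hy fun η hη => neg_nonneg.2
      (mul_nonpos_of_nonpos_of_nonneg ?_ (calibKernel_pos p z η).le)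
    exact Odd.pow_nonpos (by decide) hη.2

theorem hasDerivAt_integral_calibKernel (p z y : ℝ) :
    HasDerivAt (fun x => ∫ η in (0 : ℝ)..y, calibKernel p x η)
      (∫ η in (0 : ℝ)..y, calibKernel p z η * (2 * η + 2 * z * η ^ 2 / (p + 1))) z := by
  have hcont : Continuous fun v : ℝ × ℝ =>
      calibKernel p v.1 v.2 * (2 * v.2 + 2 * v.1 * v.2 ^ 2 / (p + 1)) := by
    have := continuous_calibKernel p
    fun_prop
  obtain ⟨C, hC⟩ := ((isCompact_closedBall z 1).prod
    (isCompact_uIcc (a := 0) (b := y))).exists_bound_of_continuousOn hcont.continuousOn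
  refine (intervalIntegral.hasDerivAt_integral_of_dominated_loc_of_deriv_le
    (F' := fun x η => calibKernel p x η * (2 * η + 2 * x * η ^ 2 / (p + 1)))
    (bound := fun _ => C) (Metric.closedBall_mem_nhds z one_pos) ?_ ?_ ?_ ?_ ?_ ?_).2
  · exact Eventually.of_forall fun x => (continuous_calibKernel_right p x).aestronglyMeasurable
  · exact (continuous_calibKernel_right p z).intervalIntegrable _ _
  · exact (hcont.comp (by fun_prop : Continuous fun η : ℝ => (z, η))).aestronglyMeasurable
  · exact Eventually.of_forall fun η hη x hx => hC (x, η) ⟨hx, uIoc_subset_uIcc hη⟩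
  · exact intervalIntegrable_const
  · exact Eventually.of_forall fun η _ x _ => hasDerivAt_calibKernel_left p x η

theorem integral_calibKernel_mul {p : ℝ} (hp : 0 < p) (z y : ℝ) :
    -2 * z * (∫ η in (0 : ℝ)..y, calibKernel p z η) + (1 - z ^ 2) / p *
      (∫ η in (0 : ℝ)..y, calibKernel p z η * (2 * η + 2 * z * η ^ 2 / (p + 1)))
      = -calibSlope p z y := by
  have hd : ∀ η ∈ uIcc 0 y, HasDerivAt
      (fun η => calibKernel p z η * (1 - (1 - z ^ 2) * η ^ 2 / (p * (p + 1))))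
      (2 * z * calibKernel p z η - (1 - z ^ 2) / p *
        (calibKernel p z η * (2 * η + 2 * z * η ^ 2 / (p + 1)))
        + 2 * (1 - z ^ 2) ^ 2 / (p * (p + 1) ^ 2) * (η ^ 3 * calibKernel p z η)) η := by
    intro η _
    have h : HasDerivAt (fun η : ℝ => 1 - (1 - z ^ 2) * η ^ 2 / (p * (p + 1)))
        (-((1 - z ^ 2) * (2 * η) / (p * (p + 1)))) η := by
      refine HasDerivAt.const_sub 1 (HasDerivAt.div_const (HasDerivAt.const_mul _ ?_) _)
      simpa using hasDerivAt_pow 2 η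
    refine ((hasDerivAt_calibKernel_right p z η).mul h).congr_deriv ?_
    field_simp
    ring
  have hk := continuous_calibKernel_right p z
  have i₁ : IntervalIntegrable (fun η => 2 * z * calibKernel p z η) volume 0 y :=
    Continuous.intervalIntegrable (by fun_prop) _ _
  have i₂ : IntervalIntegrable (fun η => (1 - z ^ 2) / p *
      (calibKernel p z η * (2 * η + 2 * z * η ^ 2 / (p + 1)))) volume 0 y :=
    Continuous.intervalIntegrable (by fun_prop) _ _
  have i₃ : IntervalIntegrable (fun η => 2 * (1 - z ^ 2) ^ 2 / (p * (p + 1) ^ 2) *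
      (η ^ 3 * calibKernel p z η)) volume 0 y :=
    Continuous.intervalIntegrable (by fun_prop) _ _
  have h := intervalIntegral.integral_eq_sub_of_hasDerivAt hd ((i₁.sub i₂).add i₃)
  rw [intervalIntegral.integral_add (i₁.sub i₂) i₃, intervalIntegral.integral_sub i₁ i₂,
    intervalIntegral.integral_const_mul, intervalIntegral.integral_const_mul,
    intervalIntegral.integral_const_mul] at h
  have h0 : calibKernel p z 0 = 1 := by simp [calibKernel]
  rw [h0] at h
  unfold calibSlope calibRemainder
  linear_combination -h

theorem one_sub_sq_pos {z : ℝ} (hz : z ∈ Ioo (-1 : ℝ) 1) : 0 < 1 - z ^ 2 := by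
  nlinarith [hz.1, hz.2]

theorem hasDerivAt_one_sub_sq_rpow (p : ℝ) {z : ℝ} (hz : z ∈ Ioo (-1 : ℝ) 1) :
    HasDerivAt (fun x : ℝ => (1 - x ^ 2) ^ p) (-2 * p * z * (1 - z ^ 2) ^ (p - 1)) z := by
  have h : HasDerivAt (fun x : ℝ => 1 - x ^ 2) (-(2 * z)) z := by
    simpa using (hasDerivAt_pow 2 z).const_sub 1
  exact (h.rpow_const (p := p) (Or.inl (one_sub_sq_pos hz).ne')).congr_deriv (by ring)

theorem one_sub_sq_rpow_eq (p : ℝ) {z : ℝ} (hz : z ∈ Ioo (-1 : ℝ) 1) :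
    (1 - z ^ 2) ^ p = (1 - z ^ 2) * (1 - z ^ 2) ^ (p - 1) := by
  rw [Real.rpow_sub_one (one_sub_sq_pos hz).ne', mul_div_cancel₀ _ (one_sub_sq_pos hz).ne']

theorem hasDerivAt_calibPotential_left {p : ℝ} (hp : 0 < p) {z : ℝ} (hz : z ∈ Ioo (-1 : ℝ) 1)
    (y : ℝ) : HasDerivAt (fun x => calibPotential p x y)
      (-((1 - z ^ 2) ^ (p - 1) * calibSlope p z y)) z := by
  refine (((hasDerivAt_one_sub_sq_rpow p hz).div_const p).mul
    (hasDerivAt_integral_calibKernel p z y)).congr_deriv ?_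
  rw [one_sub_sq_rpow_eq p hz, ← mul_neg, ← integral_calibKernel_mul hp]
  field_simp

theorem hasDerivAt_calibPotential_right (p z y : ℝ) :
    HasDerivAt (calibPotential p z) ((1 - z ^ 2) ^ p / p * calibKernel p z y) y :=
  (intervalIntegral.integral_hasDerivAt_right
    ((continuous_calibKernel_right p z).intervalIntegrable _ _)
    ((continuous_calibKernel_right p z).stronglyMeasurableAtFilter _ _)
    (continuous_calibKernel_right p z).continuousAt).const_mul _

theorem calibPotential_neg_neg (p z y : ℝ) :
    calibPotential p (-z) (-y) = -calibPotential p z y := by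
  have h := intervalIntegral.integral_comp_neg (a := -y) (b := 0) (calibKernel p z)
  have hk : ∀ η, calibKernel p (-z) η = calibKernel p z (-η) := by
    intro η
    unfold calibKernel
    ring_nf
  rw [neg_neg, neg_zero] at h
  unfold calibPotential
  simp_rw [hk]
  rw [intervalIntegral.integral_symm, h]
  simp

theorem strictMono_calibPotential {p : ℝ} (hp : 0 < p) {z : ℝ} (hz : z ∈ Ioo (-1 : ℝ) 1) :
    StrictMono (calibPotential p z) :=
  strictMono_of_deriv_pos fun y => by
    rw [(hasDerivAt_calibPotential_right p z y).deriv]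
    have := Real.rpow_pos_of_pos (one_sub_sq_pos hz) p
    have := calibKernel_pos p z y
    positivity

theorem continuous_calibPotential_right (p z : ℝ) : Continuous (calibPotential p z) :=
  continuous_iff_continuousAt.2 fun y => (hasDerivAt_calibPotential_right p z y).continuousAt

theorem continuous_calibPotential_left {p : ℝ} (hp : 0 < p) (y : ℝ) :
    Continuous fun z => calibPotential p z y := by
  have h₁ : Continuous fun z => ∫ η in (0 : ℝ)..y, calibKernel p z η :=
    continuous_iff_continuousAt.2 fun z => (hasDerivAt_integral_calibKernel p z y).continuousAt
  have h₂ : Continuous fun z : ℝ => (1 - z ^ 2) ^ p :=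
    (by fun_prop : Continuous fun z : ℝ => 1 - z ^ 2).rpow_const fun _ => Or.inr hp.le
  unfold calibPotential
  fun_prop

theorem calibSlope_add_one_le {p : ℝ} (hp : 0 < p) (z y : ℝ) :
    calibSlope p z y + 1 ≤
      calibKernel p z y * (1 - (1 - z ^ 2) * y ^ 2 / (p * (p + 1))) := by
  have := calibRemainder_nonneg p z y
  have : 0 ≤ 2 * (1 - z ^ 2) ^ 2 / (p * (p + 1) ^ 2) * calibRemainder p z y := by positivity
  unfold calibSlope
  linarith

/-- Differentiating a level-set relation for `calibPotential` bounds the density from above. -/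
theorem le_exp_of_calibration {p : ℝ} (hp : 0 < p) {z y y' g : ℝ} (hz : z ∈ Ioo (-1 : ℝ) 1)
    (h : (1 - z ^ 2) ^ p / p * calibKernel p z y * y' =
      (1 - z ^ 2) ^ (p - 1) * (1 - g) + (1 - z ^ 2) ^ (p - 1) * calibSlope p z y) :
    g ≤ Real.exp (2 * z * y - (1 - z ^ 2) * (y ^ 2 + y') / p) := by
  have hν := one_sub_sq_pos hz
  have hw := Real.rpow_pos_of_pos hν (p - 1)
  have hg : g = 1 + calibSlope p z y - (1 - z ^ 2) / p * calibKernel p z y * y' := by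
    refine mul_left_cancel₀ hw.ne' ?_
    rw [one_sub_sq_rpow_eq p hz] at h
    linear_combination h
  set X := (1 - z ^ 2) * y ^ 2 / (p * (p + 1)) + (1 - z ^ 2) / p * y' with hX
  calc g ≤ calibKernel p z y * (-X + 1) := by
        rw [hg, hX]
        linarith [calibSlope_add_one_le hp z y]
    _ ≤ calibKernel p z y * Real.exp (-X) :=
        mul_le_mul_of_nonneg_left (Real.add_one_le_exp _) (calibKernel_pos p z y).le
    _ = _ := by
        rw [calibKernel, ← Real.exp_add, hX]
        congr 1
        field_simp
        ring

theorem integrable_beta_weight {p : ℝ} (hp : 0 < p) :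
    IntervalIntegrable (fun t : ℝ => t ^ (p - 1) * (1 - t) ^ (p - 1)) volume 0 1 := by
  have h := Complex.betaIntegral_convergent (u := p) (v := p) (by simpa) (by simpa)
  rw [intervalIntegrable_iff_integrableOn_Ioc_of_le zero_le_one] at h ⊢
  refine (h.re).congr ((ae_restrict_iff' measurableSet_Ioc).2 (Eventually.of_forall fun t ht => ?_))
  have h1 : (0 : ℝ) ≤ 1 - t := by linarith [ht.2]
  have e : (t : ℂ) ^ ((p : ℂ) - 1) * (1 - (t : ℂ)) ^ ((p : ℂ) - 1) =
      ((t ^ (p - 1) * (1 - t) ^ (p - 1) : ℝ) : ℂ) := by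
    push_cast [Complex.ofReal_cpow ht.1.le, Complex.ofReal_cpow h1]
    rfl
  simp only [e]
  exact Complex.ofReal_re _

theorem integral_beta_weight {p : ℝ} (hp : 0 < p) :
    ∫ t in (0 : ℝ)..1, t ^ (p - 1) * (1 - t) ^ (p - 1) = ProbabilityTheory.beta p p := by
  rw [ProbabilityTheory.beta_eq_betaIntegralReal p p hp hp, Complex.betaIntegral]
  have e : ∫ t in (0 : ℝ)..1, (t : ℂ) ^ ((p : ℂ) - 1) * (1 - (t : ℂ)) ^ ((p : ℂ) - 1) =
      ∫ t in (0 : ℝ)..1, ((t ^ (p - 1) * (1 - t) ^ (p - 1) : ℝ) : ℂ) := by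
    refine intervalIntegral.integral_congr fun t ht => ?_
    rw [uIcc_of_le zero_le_one] at ht
    have h1 : (0 : ℝ) ≤ 1 - t := by linarith [ht.2]
    push_cast [Complex.ofReal_cpow ht.1, Complex.ofReal_cpow h1]
    rfl
  rw [e, intervalIntegral.integral_ofReal, Complex.ofReal_re]

theorem beta_weight_comp {p z : ℝ} (hz : z ∈ Icc (-1 : ℝ) 1) :
    (1 - z ^ 2) ^ (p - 1) = 4 ^ (p - 1) *
      ((z * 2⁻¹ + 2⁻¹) ^ (p - 1) * (1 - (z * 2⁻¹ + 2⁻¹)) ^ (p - 1)) := by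
  rw [← Real.mul_rpow (by linarith [hz.1]) (by linarith [hz.2]), ← Real.mul_rpow (by norm_num)]
  · congr 1
    ring
  · nlinarith [hz.1, hz.2]

theorem intervalIntegrable_weight {p : ℝ} (hp : 0 < p) :
    IntervalIntegrable (fun z : ℝ => (1 - z ^ 2) ^ (p - 1)) volume (-1) 1 := by
  have h := (((integrable_beta_weight hp).comp_add_right (2⁻¹)).comp_mul_right
    (c := 2⁻¹)).const_mul (4 ^ (p - 1))
  have h' : IntervalIntegrable (fun z : ℝ => 4 ^ (p - 1) *
      ((z * 2⁻¹ + 2⁻¹) ^ (p - 1) * (1 - (z * 2⁻¹ + 2⁻¹)) ^ (p - 1))) volume (-1) 1 := by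
    convert h using 1 <;> norm_num
  refine h'.congr fun z hz => ?_
  rw [uIoc_of_le (by norm_num)] at hz
  exact (beta_weight_comp (Ioc_subset_Icc_self hz)).symm

theorem integral_weight {p : ℝ} (hp : 0 < p) :
    ∫ z in (-1 : ℝ)..1, (1 - z ^ 2) ^ (p - 1) =
      Real.sqrt π * Real.Gamma p / Real.Gamma (p + 1 / 2) := by
  have e : ∫ z in (-1 : ℝ)..1, (1 - z ^ 2) ^ (p - 1) = ∫ z in (-1 : ℝ)..1, 4 ^ (p - 1) *
      ((z * 2⁻¹ + 2⁻¹) ^ (p - 1) * (1 - (z * 2⁻¹ + 2⁻¹)) ^ (p - 1)) := by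
    refine intervalIntegral.integral_congr fun z hz => ?_
    rw [uIcc_of_le (by norm_num)] at hz
    exact beta_weight_comp hz
  have hc := intervalIntegral.integral_comp_mul_add (a := -1) (b := 1)
    (fun t : ℝ => t ^ (p - 1) * (1 - t) ^ (p - 1)) (c := 2⁻¹) (by norm_num) 2⁻¹
  simp only [mul_comm (2⁻¹ : ℝ)] at hc
  rw [e, intervalIntegral.integral_const_mul, hc]
  norm_num
  rw [integral_beta_weight hp, ProbabilityTheory.beta]
  have hG := Real.Gamma_mul_Gamma_add_half p
  have h1 := Real.Gamma_pos_of_pos hp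
  have h2 := Real.Gamma_pos_of_pos (show 0 < p + 1 / 2 by positivity)
  have h3 := Real.Gamma_pos_of_pos (show 0 < 2 * p by positivity)
  have h4 : (4 : ℝ) ^ (p - 1) * 2 * 2 ^ (1 - 2 * p) = 1 := by
    have e4 : (4 : ℝ) ^ (p - 1) = 2 ^ (2 * (p - 1)) := by
      rw [Real.rpow_mul zero_le_two]
      norm_num
    have e2 : (2 : ℝ) ^ (2 * (p - 1)) * 2 ^ (1 : ℝ) * 2 ^ (1 - 2 * p) = 1 := by
      rw [← Real.rpow_add two_pos, ← Real.rpow_add two_pos]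
      ring_nf
      simp
    rw [Real.rpow_one] at e2
    rwa [e4]
  rw [← two_mul]
  generalize Real.Gamma (p + 1 / 2) = b at hG h2 ⊢
  generalize Real.Gamma (2 * p) = d at hG h3 ⊢
  field_simp
  linear_combination (4 : ℝ) ^ (p - 1) * 2 * hG + d * Real.sqrt π * h4

/-- A continuous function is integrable against the ultraspherical weight on `[-1, 1]`. -/
theorem intervalIntegrable_weight_mul {p : ℝ} (hp : 0 < p) {g : ℝ → ℝ} (hg : Continuous g) :
    IntervalIntegrable (fun z : ℝ => (1 - z ^ 2) ^ (p - 1) * g z) volume (-1) 1 :=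
  (intervalIntegrable_weight hp).mul_continuousOn hg.continuousOn

theorem continuousAt_weight (p : ℝ) {z : ℝ} (hz : z ∈ Ioo (-1 : ℝ) 1) :
    ContinuousAt (fun z : ℝ => (1 - z ^ 2) ^ (p - 1)) z :=
  (hasDerivAt_one_sub_sq_rpow (p - 1) hz).continuousAt

theorem hasDerivAt_integral_weight_mul {p : ℝ} (hp : 0 < p) {g : ℝ → ℝ} (hg : Continuous g)
    {z : ℝ} (hz : z ∈ Ioo (-1 : ℝ) 1) :
    HasDerivAt (fun x => ∫ t in (-1 : ℝ)..x, (1 - t ^ 2) ^ (p - 1) * g t)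
      ((1 - z ^ 2) ^ (p - 1) * g z) z := by
  refine intervalIntegral.integral_hasDerivAt_right ?_ ?_
    ((continuousAt_weight p hz).mul hg.continuousAt)
  · refine (intervalIntegrable_weight_mul hp hg).mono_set ?_
    rw [uIcc_of_le hz.1.le, uIcc_of_le (by norm_num)]
    exact Icc_subset_Icc_right hz.2.le
  · exact ContinuousOn.stronglyMeasurableAtFilter isOpen_Ioo
      (fun x hx => ((continuousAt_weight p hx).mul hg.continuousAt).continuousWithinAt) z hz

/-- The mass of `[-1, z]` for the unnormalised ultraspherical weight. -/
noncomputable def weightMass (p z : ℝ) : ℝ := ∫ t in (-1 : ℝ)..z, (1 - t ^ 2) ^ (p - 1)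

theorem hasDerivAt_weightMass {p : ℝ} (hp : 0 < p) {z : ℝ} (hz : z ∈ Ioo (-1 : ℝ) 1) :
    HasDerivAt (weightMass p) ((1 - z ^ 2) ^ (p - 1)) z := by
  simpa only [mul_one] using! hasDerivAt_integral_weight_mul hp (continuous_const (y := (1 : ℝ))) hz

theorem continuousOn_weightMass {p : ℝ} (hp : 0 < p) :
    ContinuousOn (weightMass p) (Icc (-1) 1) := by
  have h := intervalIntegrable_weight hp
  have := intervalIntegral.continuousOn_primitive_interval' h left_mem_uIcc
  rwa [uIcc_of_le (by norm_num)] at this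

theorem weightMass_neg {p : ℝ} (hp : 0 < p) {z : ℝ} (hz : z ∈ Icc (-1 : ℝ) 1) :
    weightMass p (-z) = weightMass p 1 - weightMass p z := by
  have h := intervalIntegrable_weight hp
  have h₁ : IntervalIntegrable (fun z : ℝ => (1 - z ^ 2) ^ (p - 1)) volume (-1) z := by
    refine h.mono_set ?_
    rw [uIcc_of_le hz.1, uIcc_of_le (by norm_num)]
    exact Icc_subset_Icc_right hz.2
  have h₂ := intervalIntegral.integral_comp_neg (a := -1) (b := -z)
    fun z : ℝ => (1 - z ^ 2) ^ (p - 1)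
  simp only [neg_sq, neg_neg] at h₂
  unfold weightMass
  rw [h₂, intervalIntegral.integral_interval_sub_left h h₁]

theorem exists_calibPotential_le {p : ℝ} (hp : 0 < p) {δ : ℝ} (hδ : 0 < δ) {z₀ : ℝ}
    (hz₀ : z₀ ∈ Ioo (-1 : ℝ) 1) :
    ∃ N : ℝ, ∀ z ∈ Ico z₀ 1,
      calibPotential p z (-N) ≤ -((1 - δ) * (weightMass p 1 - weightMass p z)) := by
  set m := min (1 - z₀ ^ 2) (3 / 4) with hm
  have hm0 : 0 < m := lt_min (one_sub_sq_pos hz₀) (by norm_num)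
  obtain ⟨N, hN0, hNδ, hNm⟩ : ∃ N : ℝ, 0 ≤ N ∧ Real.exp (-N) ≤ δ ∧ p * (p + 1) ≤ m * N ^ 2 := by
    have h₁ : ∀ᶠ N : ℝ in atTop, Real.exp (-N) < δ :=
      Real.tendsto_exp_neg_atTop_nhds_zero.eventually_lt_const hδ
    have h₂ : ∀ᶠ N : ℝ in atTop, p * (p + 1) ≤ m * N ^ 2 :=
      ((tendsto_pow_atTop two_ne_zero).const_mul_atTop hm0).eventually_ge_atTop _
    obtain ⟨N, h⟩ := ((eventually_ge_atTop 0).and (h₁.and h₂)).exists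
    exact ⟨N, h.1, h.2.1.le, h.2.2⟩
  refine ⟨N, fun z hz => ?_⟩
  have hsub : Icc z₀ 1 ⊆ Icc (-1 : ℝ) 1 := Icc_subset_Icc_left hz₀.1.le
  let K : ℝ → ℝ := fun z => -calibPotential p z (-N) - (1 - δ) * (weightMass p 1 - weightMass p z)
  have hK : AntitoneOn K (Icc z₀ 1) := by
    have hd : ∀ x ∈ Ioo z₀ 1, HasDerivAt K
        ((1 - x ^ 2) ^ (p - 1) * (calibSlope p x (-N) + 1 - δ)) x := by
      intro x hx
      have hx' : x ∈ Ioo (-1 : ℝ) 1 := ⟨hz₀.1.trans hx.1, hx.2⟩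
      exact ((hasDerivAt_calibPotential_left hp hx' (-N)).neg.sub
        (((hasDerivAt_weightMass hp hx').const_sub _).const_mul _)).congr_deriv (by ring)
    refine antitoneOn_of_deriv_nonpos (convex_Icc _ _) ?_ ?_ ?_
    · exact (continuous_calibPotential_left hp (-N)).neg.continuousOn.sub
        (continuousOn_const.mul (continuousOn_const.sub ((continuousOn_weightMass hp).mono hsub)))
    · rw [interior_Icc]
      exact fun x hx => (hd x hx).differentiableAt.differentiableWithinAt
    · rw [interior_Icc]
      intro x hx
      have hν := one_sub_sq_pos (z := x) ⟨hz₀.1.trans hx.1, hx.2⟩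
      rw [(hd x hx).deriv]
      refine mul_nonpos_of_nonneg_of_nonpos (Real.rpow_nonneg hν.le _) ?_
      have hS := calibSlope_add_one_le hp x (-N)
      have hk := calibKernel_pos p x (-N)
      have hpp : 0 < p * (p + 1) := by positivity
      rcases le_or_gt m (1 - x ^ 2) with hmx | hmx
      · have : 1 ≤ (1 - x ^ 2) * (-N) ^ 2 / (p * (p + 1)) := by
          rw [le_div_iff₀ hpp, neg_sq, one_mul]
          exact hNm.trans (mul_le_mul_of_nonneg_right hmx (sq_nonneg N))
        nlinarith
      · have hx2 : 1 / 2 ≤ x := by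
          by_contra! hlt
          refine hmx.not_ge ?_
          rcases le_total 0 x with h0 | h0
          · exact (min_le_right _ _).trans (by nlinarith)
          · exact (min_le_left _ _).trans (by nlinarith [hx.1])
        have hkδ : calibKernel p x (-N) ≤ δ := by
          refine le_trans (Real.exp_le_exp.2 ?_) hNδ
          have : 0 ≤ (1 - x ^ 2) * (-N) ^ 2 / (p + 1) := by positivity
          nlinarith
        have : 0 ≤ (1 - x ^ 2) * (-N) ^ 2 / (p * (p + 1)) := by positivity
        nlinarith
  have h := hK ⟨hz.1, hz.2.le⟩ ⟨hz₀.2.le, le_rfl⟩ hz.2.le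
  have h1 : K 1 = 0 := by simp [K, calibPotential, hp.ne']
  simp only [h1, K] at h
  linarith

theorem exists_le_calibPotential {p : ℝ} (hp : 0 < p) {δ : ℝ} (hδ : 0 < δ) {z₀ : ℝ}
    (hz₀ : z₀ ∈ Ioo (-1 : ℝ) 1) :
    ∃ N : ℝ, ∀ z ∈ Ioc (-1) z₀, (1 - δ) * weightMass p z ≤ calibPotential p z N := by
  obtain ⟨N, hN⟩ := exists_calibPotential_le hp hδ (z₀ := -z₀)
    ⟨neg_lt_neg hz₀.2, by linarith [hz₀.1]⟩
  refine ⟨N, fun z hz => ?_⟩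
  have h := hN (-z) ⟨neg_le_neg hz.2, by linarith [hz.1]⟩
  rw [calibPotential_neg_neg, weightMass_neg hp ⟨hz.1.le, hz.2.trans hz₀.2.le⟩] at h
  linarith

/-- The calibrating slope of a density `g`: a differentiable `y` on `(-1, 1)` dominating `log g`,
with one-sided bounds at both ends. -/
theorem exists_calibrating_slope {p : ℝ} (hp : 0 < p) {g : ℝ → ℝ} (hg : Continuous g) {δ : ℝ}
    (hδ : 0 < δ) (hδg : ∀ z, δ ≤ g z)
    (hint : ∫ z in (-1 : ℝ)..1, (1 - z ^ 2) ^ (p - 1) * g z = weightMass p 1) :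
    ∃ y y' : ℝ → ℝ, ∃ N : ℝ, (∀ z ∈ Ioo (-1 : ℝ) 1, HasDerivAt y (y' z) z ∧
        g z ≤ Real.exp (2 * z * y z - (1 - z ^ 2) * (y z ^ 2 + y' z) / p)) ∧
      (∀ z ∈ Ico (0 : ℝ) 1, -N ≤ y z) ∧ ∀ z ∈ Ioc (-1 : ℝ) 0, y z ≤ N := by
  let B : ℝ → ℝ := fun x => ∫ t in (-1 : ℝ)..x, (1 - t ^ 2) ^ (p - 1) * g t
  let A : ℝ → ℝ := fun x => weightMass p x - B x
  have hii : ∀ {a b}, a ∈ Icc (-1 : ℝ) 1 → b ∈ Icc (-1 : ℝ) 1 →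
      IntervalIntegrable (fun z : ℝ => (1 - z ^ 2) ^ (p - 1)) volume a b ∧
      IntervalIntegrable (fun z : ℝ => (1 - z ^ 2) ^ (p - 1) * g z) volume a b := by
    intro a b ha hb
    have hs : uIcc a b ⊆ uIcc (-1) 1 := by
      rw [uIcc_of_le (show (-1 : ℝ) ≤ 1 by norm_num)]
      exact uIcc_subset_Icc ha hb
    exact ⟨(intervalIntegrable_weight hp).mono_set hs,
      (intervalIntegrable_weight_mul hp hg).mono_set hs⟩
  have hle : ∀ {a b}, a ∈ Icc (-1 : ℝ) 1 → b ∈ Icc (-1 : ℝ) 1 → a ≤ b →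
      δ * ∫ z in a..b, (1 - z ^ 2) ^ (p - 1) ≤ ∫ z in a..b, (1 - z ^ 2) ^ (p - 1) * g z := by
    intro a b ha hb hab
    rw [← intervalIntegral.integral_const_mul]
    refine intervalIntegral.integral_mono_on hab ((hii ha hb).1.const_mul δ) (hii ha hb).2 ?_
    intro z hz
    rw [mul_comm]
    refine mul_le_mul_of_nonneg_left (hδg z) (Real.rpow_nonneg ?_ _)
    nlinarith [ha.1.trans hz.1, hz.2.trans hb.2]
  have hm1 : (-1 : ℝ) ∈ Icc (-1 : ℝ) 1 := by norm_num
  have h1 : (1 : ℝ) ∈ Icc (-1 : ℝ) 1 := by norm_num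
  have hAle : ∀ z ∈ Icc (-1 : ℝ) 1, A z ≤ (1 - δ) * weightMass p z := by
    intro z hz
    have := hle hm1 hz hz.1
    simp only [A, B, weightMass]
    linarith
  have hleA : ∀ z ∈ Icc (-1 : ℝ) 1, -((1 - δ) * (weightMass p 1 - weightMass p z)) ≤ A z := by
    intro z hz
    have h := hle hz h1 hz.2
    have e₁ := intervalIntegral.integral_interval_sub_left (hii hm1 h1).1 (hii hm1 hz).1
    have e₂ := intervalIntegral.integral_interval_sub_left (hii hm1 h1).2 (hii hm1 hz).2
    rw [← e₁, ← e₂, hint] at h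
    simp only [A, B]
    change δ * (weightMass p 1 - weightMass p z) ≤ _ at h
    linarith
  have hex : ∀ z, ∃ t, z ∈ Ioo (-1 : ℝ) 1 → calibPotential p z t = A z := by
    intro z
    by_cases hz : z ∈ Ioo (-1 : ℝ) 1
    · obtain ⟨N, hN⟩ := exists_calibPotential_le hp hδ hz
      obtain ⟨M, hM⟩ := exists_le_calibPotential hp hδ hz
      obtain ⟨t, ht⟩ := mem_range_of_exists_le_of_exists_ge (continuous_calibPotential_right p z)
        ⟨-N, (hN z ⟨le_rfl, hz.2⟩).trans (hleA z ⟨hz.1.le, hz.2.le⟩)⟩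
        ⟨M, (hAle z ⟨hz.1.le, hz.2.le⟩).trans (hM z ⟨hz.1, le_rfl⟩)⟩
      exact ⟨t, fun _ => ht⟩
    · exact ⟨0, fun h => absurd h hz⟩
  choose y hy using hex
  have h0 : (0 : ℝ) ∈ Ioo (-1 : ℝ) 1 := by norm_num
  obtain ⟨N, hN⟩ := exists_calibPotential_le hp hδ h0
  obtain ⟨M, hM⟩ := exists_le_calibPotential hp hδ h0
  let F₁ : ℝ → ℝ → ℝ := fun z t => -((1 - z ^ 2) ^ (p - 1) * calibSlope p z t)
    - ((1 - z ^ 2) ^ (p - 1) - (1 - z ^ 2) ^ (p - 1) * g z)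
  let F₂ : ℝ → ℝ → ℝ := fun z t => (1 - z ^ 2) ^ p / p * calibKernel p z t
  refine ⟨y, fun z => -(F₁ z (y z) / F₂ z (y z)), max N M, fun z hz => ?_, fun z hz => ?_,
    fun z hz => ?_⟩
  · have hnhds : ∀ᶠ x in 𝓝 z, x ∈ Ioo (-1 : ℝ) 1 := isOpen_Ioo.mem_nhds hz
    have hF₂ : F₂ z (y z) ≠ 0 := by
      have := Real.rpow_pos_of_pos (one_sub_sq_pos hz) p
      have := calibKernel_pos p z (y z)
      positivity
    have hfst : ContinuousAt (fun v : ℝ × ℝ => v.1) (z, y z) := continuousAt_fst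
    have hw := ContinuousAt.comp (f := fun v : ℝ × ℝ => v.1) (x := (z, y z))
      (continuousAt_weight p hz) hfst
    refine ⟨hasDerivAt_of_implicit_eq (F := fun z t => calibPotential p z t - A z)
      (F₁ := F₁) (F₂ := F₂) ?_ ?_ ?_ ?_ hF₂ ?_, le_exp_of_calibration hp hz ?_⟩
    · filter_upwards [hfst.eventually hnhds] with v hv
      exact (hasDerivAt_calibPotential_left hp hv v.2).sub
        ((hasDerivAt_weightMass hp hv).sub (hasDerivAt_integral_weight_mul hp hg hv))
    · exact Eventually.of_forall fun v => (hasDerivAt_calibPotential_right p v.1 v.2).sub_const _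
    · exact ((hw.mul (continuous_calibSlope p).continuousAt).neg).sub
        (hw.sub (hw.mul (hg.comp continuous_fst).continuousAt))
    · have hr := ContinuousAt.comp (f := fun v : ℝ × ℝ => v.1) (x := (z, y z))
        (hasDerivAt_one_sub_sq_rpow p hz).continuousAt hfst
      exact (hr.div_const p).mul (continuous_calibKernel p).continuousAt
    · filter_upwards [hnhds] with x hx t ht
      refine (strictMono_calibPotential hp hx).injective ?_
      simp only [hy z hz, sub_self] at ht
      rw [hy x hx]
      linarith
    · change F₂ z (y z) * _ = _
      rw [mul_neg, mul_div_cancel₀ _ hF₂]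
      simp only [F₁]
      ring
  · have hz' : z ∈ Ioo (-1 : ℝ) 1 := ⟨by linarith [hz.1], hz.2⟩
    refine le_trans (neg_le_neg (le_max_left N M))
      ((strictMono_calibPotential hp hz').le_iff_le.1 ?_)
    rw [hy z hz']
    exact (hN z hz).trans (hleA z ⟨hz'.1.le, hz'.2.le⟩)
  · have hz' : z ∈ Ioo (-1 : ℝ) 1 := ⟨hz.1, by linarith [hz.2]⟩
    refine le_trans ((strictMono_calibPotential hp hz').le_iff_le.1 ?_) (le_max_right N M)
    rw [hy z hz']
    exact (hAle z ⟨hz'.1.le, hz'.2.le⟩).trans (hM z hz)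

/-- The logarithmic Sobolev inequality on `[-1, 1]` relative to a positive density `g`. -/
theorem integral_entropy_sub_energy_nonpos {p : ℝ} (hp : 0 < p) {f g : ℝ → ℝ}
    (hf : Differentiable ℝ f) (hg : Continuous g) {δ : ℝ} (hδ : 0 < δ) (hδg : ∀ z, δ ≤ g z)
    (hint : ∫ z in (-1 : ℝ)..1, (1 - z ^ 2) ^ (p - 1) * g z = weightMass p 1)
    (hφ : IntervalIntegrable (fun z => (1 - z ^ 2) ^ (p - 1) *
      (p * (f z ^ 2 * Real.log (g z)) - deriv f z ^ 2 * (1 - z ^ 2))) volume (-1) 1) :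
    ∫ z in (-1 : ℝ)..1, (1 - z ^ 2) ^ (p - 1) *
      (p * (f z ^ 2 * Real.log (g z)) - deriv f z ^ 2 * (1 - z ^ 2)) ≤ 0 := by
  obtain ⟨y, y', N, hy, hyr, hyl⟩ := exists_calibrating_slope hp hg hδ hδg hint
  set φ : ℝ → ℝ := fun z => (1 - z ^ 2) ^ (p - 1) *
    (p * (f z ^ 2 * Real.log (g z)) - deriv f z ^ 2 * (1 - z ^ 2)) with hφdef
  let H : ℝ → ℝ := fun z => -((1 - z ^ 2) ^ p * y z * f z ^ 2)
  let H' : ℝ → ℝ := fun z => -((-2 * p * z * (1 - z ^ 2) ^ (p - 1) * y z + (1 - z ^ 2) ^ p * y' z)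
    * f z ^ 2 + (1 - z ^ 2) ^ p * y z * (2 * f z * deriv f z))
  have hH : ∀ z ∈ Ioo (-1 : ℝ) 1, HasDerivAt H (H' z) z := by
    intro z hz
    refine ((((hasDerivAt_one_sub_sq_rpow p hz).mul (hy z hz).1).mul
      ((hf z).hasDerivAt.pow 2)).neg).congr_deriv ?_
    simp [H']
  have hφH : ∀ z ∈ Ioo (-1 : ℝ) 1, φ z ≤ H' z := by
    intro z hz
    have hν := one_sub_sq_pos hz
    have hw := Real.rpow_pos_of_pos hν (p - 1)
    have hlog := Real.log_le_log (hδ.trans_le (hδg z)) (hy z hz).2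
    rw [Real.log_exp] at hlog
    have hlog' : p * Real.log (g z) ≤ 2 * p * z * y z - (1 - z ^ 2) * (y z ^ 2 + y' z) := by
      refine (mul_le_mul_of_nonneg_left hlog hp.le).trans_eq ?_
      field_simp
    have h₁ := mul_le_mul_of_nonneg_left hlog' (mul_nonneg hw.le (sq_nonneg (f z)))
    have h₂ := mul_nonneg (mul_nonneg hw.le hν.le) (sq_nonneg (deriv f z - y z * f z))
    simp only [φ, H', one_sub_sq_rpow_eq p hz]
    linarith
  have hsub : ∀ b ∈ Ioo (0 : ℝ) 1, Icc (-b) b ⊆ Ioo (-1 : ℝ) 1 := fun b hb z hz =>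
    ⟨by linarith [hz.1, hb.2], hz.2.trans_lt hb.2⟩
  have hle : ∀ b ∈ Ioo (0 : ℝ) 1, ∫ z in (-b)..b, φ z ≤
      N * ((1 - b ^ 2) ^ p * (f b ^ 2 + f (-b) ^ 2)) := by
    intro b hb
    have hbm : b ∈ Ioo (-1 : ℝ) 1 := ⟨by linarith [hb.1], hb.2⟩
    have h := intervalIntegral.integral_le_sub_of_hasDeriv_right_of_le (g := H) (g' := H') (φ := φ)
      (show -b ≤ b by linarith [hb.1])
      (fun z hz => (hH z (hsub b hb hz)).continuousAt.continuousWithinAt)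
      (fun z hz => (hH z (hsub b hb (Ioo_subset_Icc_self hz))).hasDerivWithinAt)
      ?_ (fun z hz => hφH z (hsub b hb (Ioo_subset_Icc_self hz)))
    · have hr := Real.rpow_pos_of_pos (one_sub_sq_pos hbm) p
      have h₁ := mul_le_mul_of_nonneg_left (hyr b ⟨hb.1.le, hb.2⟩)
        (mul_nonneg hr.le (sq_nonneg (f b)))
      have h₂ := mul_le_mul_of_nonneg_left (hyl (-b) ⟨by linarith [hb.2], by linarith [hb.1]⟩)
        (mul_nonneg hr.le (sq_nonneg (f (-b))))
      simp only [H, neg_sq] at h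
      linarith
    · rw [intervalIntegrable_iff_integrableOn_Icc_of_le (by norm_num)] at hφ
      exact hφ.mono_set ((hsub b hb).trans Ioo_subset_Icc_self)
  have hev : ∀ᶠ b in 𝓝[<] (1 : ℝ), b ∈ Ioo (0 : ℝ) 1 := Ioo_mem_nhdsLT one_pos
  have hlim : Tendsto (fun b : ℝ => ∫ z in (-b)..b, φ z) (𝓝[<] 1)
      (𝓝 (∫ z in (-1 : ℝ)..1, φ z)) := by
    have hc := intervalIntegral.continuousOn_primitive_interval' hφ left_mem_uIcc
    rw [uIcc_of_le (by norm_num)] at hc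
    have hIcc : ∀ᶠ b in 𝓝[<] (1 : ℝ), b ∈ Icc (-1 : ℝ) 1 ∧ -b ∈ Icc (-1 : ℝ) 1 := by
      filter_upwards [hev] with b hb
      exact ⟨⟨by linarith [hb.1], hb.2.le⟩, by linarith [hb.2], by linarith [hb.1]⟩
    have t₁ : Tendsto (fun b : ℝ => b) (𝓝[<] 1) (𝓝[Icc (-1) 1] 1) :=
      tendsto_nhdsWithin_iff.2 ⟨tendsto_nhdsWithin_of_tendsto_nhds tendsto_id,
        hIcc.mono fun b hb => hb.1⟩
    have t₂ : Tendsto (fun b : ℝ => -b) (𝓝[<] 1) (𝓝[Icc (-1) 1] (-1)) :=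
      tendsto_nhdsWithin_iff.2 ⟨tendsto_nhdsWithin_of_tendsto_nhds (continuous_neg.tendsto 1),
        hIcc.mono fun b hb => hb.2⟩
    have h := ((hc 1 (by norm_num)).tendsto.comp t₁).sub ((hc (-1) (by norm_num)).tendsto.comp t₂)
    simp only [intervalIntegral.integral_same, sub_zero] at h
    refine h.congr' ?_
    filter_upwards [hIcc] with b hb
    have hs : ∀ x ∈ Icc (-1 : ℝ) 1, IntervalIntegrable φ volume (-1) x := fun x hx => by
      refine hφ.mono_set ?_
      rw [uIcc_of_le hx.1, uIcc_of_le (by norm_num)]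
      exact Icc_subset_Icc_right hx.2
    exact intervalIntegral.integral_interval_sub_left (hs b hb.1) (hs (-b) hb.2)
  have hlim₀ : Tendsto (fun b : ℝ => N * ((1 - b ^ 2) ^ p * (f b ^ 2 + f (-b) ^ 2)))
      (𝓝[<] 1) (𝓝 0) := by
    have hfc := hf.continuous
    have hr : Continuous fun b : ℝ => (1 - b ^ 2) ^ p :=
      (by fun_prop : Continuous fun b : ℝ => 1 - b ^ 2).rpow_const fun _ => Or.inr hp.le
    have hc : Continuous fun b : ℝ => N * ((1 - b ^ 2) ^ p * (f b ^ 2 + f (-b) ^ 2)) := by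
      fun_prop
    have := hc.tendsto 1
    simp only [one_pow, sub_self, Real.zero_rpow hp.ne', zero_mul, mul_zero] at this
    exact tendsto_nhdsWithin_of_tendsto_nhds this
  exact le_of_tendsto_of_tendsto hlim hlim₀ (hev.mono hle)

/-- The sharp logarithmic Sobolev inequality for the unnormalised ultraspherical weight. -/
theorem logSobolev_weight {p : ℝ} (hp : 0 < p) {f : ℝ → ℝ} (hf : Differentiable ℝ f) {m : ℝ}
    (hm : ∫ z in (-1 : ℝ)..1, (1 - z ^ 2) ^ (p - 1) * f z ^ 2 = m * weightMass p 1)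
    (hlog : IntervalIntegrable (fun z => (1 - z ^ 2) ^ (p - 1) *
      (f z ^ 2 * Real.log (f z ^ 2 / m))) volume (-1) 1)
    (hf' : IntervalIntegrable (fun z => (1 - z ^ 2) ^ (p - 1) *
      (deriv f z ^ 2 * (1 - z ^ 2))) volume (-1) 1) :
    p * ∫ z in (-1 : ℝ)..1, (1 - z ^ 2) ^ (p - 1) * (f z ^ 2 * Real.log (f z ^ 2 / m)) ≤
      ∫ z in (-1 : ℝ)..1, (1 - z ^ 2) ^ (p - 1) * (deriv f z ^ 2 * (1 - z ^ 2)) := by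
  have hfc := hf.continuous
  have hwnn : ∀ z ∈ Icc (-1 : ℝ) 1, 0 ≤ (1 - z ^ 2) ^ (p - 1) := fun z hz =>
    Real.rpow_nonneg (by nlinarith [hz.1, hz.2]) _
  have hZ : 0 < weightMass p 1 := by
    unfold weightMass
    rw [integral_weight hp]
    have := Real.Gamma_pos_of_pos hp
    have := Real.Gamma_pos_of_pos (show 0 < p + 1 / 2 by positivity)
    positivity
  have hm0 : 0 ≤ m := by
    have : 0 ≤ m * weightMass p 1 := hm ▸ intervalIntegral.integral_nonneg (by norm_num)
      fun z hz => mul_nonneg (hwnn z hz) (sq_nonneg _)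
    exact nonneg_of_mul_nonneg_left this hZ
  rcases hm0.eq_or_lt with rfl | hmpos
  · simp only [div_zero, Real.log_zero, mul_zero, intervalIntegral.integral_zero]
    refine intervalIntegral.integral_nonneg (by norm_num) fun z hz => mul_nonneg (hwnn z hz) ?_
    exact mul_nonneg (sq_nonneg _) (by nlinarith [hz.1, hz.2])
  have key : ∀ ε > 0, p * (∫ z in (-1 : ℝ)..1, (1 - z ^ 2) ^ (p - 1) *
      (f z ^ 2 * Real.log (f z ^ 2 / m))) ≤
      (∫ z in (-1 : ℝ)..1, (1 - z ^ 2) ^ (p - 1) * (deriv f z ^ 2 * (1 - z ^ 2))) +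
        p * (m * weightMass p 1) * Real.log ((m + ε) / m) := by
    intro ε hε
    let g : ℝ → ℝ := fun z => (f z ^ 2 + ε) / (m + ε)
    have hmε : 0 < m + ε := by positivity
    have hg : Continuous g := by fun_prop
    have hgpos : ∀ z, ε / (m + ε) ≤ g z := fun z =>
      div_le_div_of_nonneg_right (by linarith [sq_nonneg (f z)]) hmε.le
    have hg0 : ∀ z, g z ≠ 0 := fun z => ((div_pos hε hmε).trans_le (hgpos z)).ne'
    have i₁ : IntervalIntegrable (fun z : ℝ => (1 - z ^ 2) ^ (p - 1) * f z ^ 2) volume (-1) 1 :=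
      intervalIntegrable_weight_mul hp (hfc.pow 2)
    have i₂ := intervalIntegrable_weight hp
    have hgint : ∫ z in (-1 : ℝ)..1, (1 - z ^ 2) ^ (p - 1) * g z = weightMass p 1 := by
      have e : ∀ z, (1 - z ^ 2) ^ (p - 1) * g z =
          ((1 - z ^ 2) ^ (p - 1) * f z ^ 2 + (1 - z ^ 2) ^ (p - 1) * ε) / (m + ε) := by
        intro z
        simp only [g]
        ring
      simp_rw [e]
      rw [intervalIntegral.integral_div, intervalIntegral.integral_add i₁ (i₂.mul_const ε), hm,
        intervalIntegral.integral_mul_const, div_eq_iff hmε.ne']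
      unfold weightMass
      ring
    have i₃ : IntervalIntegrable (fun z : ℝ => (1 - z ^ 2) ^ (p - 1) *
        (p * (f z ^ 2 * Real.log (g z)))) volume (-1) 1 :=
      intervalIntegrable_weight_mul hp (continuous_const.mul ((hfc.pow 2).mul (hg.log hg0)))
    have i₄ : IntervalIntegrable (fun z => (1 - z ^ 2) ^ (p - 1) *
        (p * (f z ^ 2 * Real.log (g z)) - deriv f z ^ 2 * (1 - z ^ 2))) volume (-1) 1 :=
      (i₃.sub hf').congr fun z _ => (mul_sub _ _ _).symm
    have hmain := integral_entropy_sub_energy_nonpos hp hf hg (div_pos hε hmε) hgpos hgint i₄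
    have hcmp : p * (∫ z in (-1 : ℝ)..1, (1 - z ^ 2) ^ (p - 1) *
        (f z ^ 2 * Real.log (f z ^ 2 / m))) ≤
        ∫ z in (-1 : ℝ)..1, ((1 - z ^ 2) ^ (p - 1) *
          (p * (f z ^ 2 * Real.log (g z)) - deriv f z ^ 2 * (1 - z ^ 2)) +
          (1 - z ^ 2) ^ (p - 1) * (deriv f z ^ 2 * (1 - z ^ 2)) +
          (1 - z ^ 2) ^ (p - 1) * f z ^ 2 * (p * Real.log ((m + ε) / m))) := by
      rw [← intervalIntegral.integral_const_mul]
      refine intervalIntegral.integral_mono_on (by norm_num) (hlog.const_mul p)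
        ((i₄.add hf').add (i₁.mul_const _)) fun z hz => ?_
      have hpt : f z ^ 2 * Real.log (f z ^ 2 / m) ≤
          f z ^ 2 * (Real.log (g z) + Real.log ((m + ε) / m)) := by
        rcases (sq_nonneg (f z)).eq_or_lt with h0 | h0
        · simp [← h0]
        · refine mul_le_mul_of_nonneg_left ?_ h0.le
          rw [← Real.log_mul (hg0 z) (by positivity)]
          refine Real.log_le_log (by positivity) ?_
          rw [div_mul_div_cancel₀ hmε.ne']
          exact div_le_div_of_nonneg_right (by linarith) hmpos.le
      have := mul_le_mul_of_nonneg_left hpt (mul_nonneg hp.le (hwnn z hz))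
      linarith
    rw [intervalIntegral.integral_add (i₄.add hf') (i₁.mul_const _),
      intervalIntegral.integral_add i₄ hf', intervalIntegral.integral_mul_const, hm] at hcmp
    linarith
  have hlim : Tendsto (fun ε : ℝ =>
      (∫ z in (-1 : ℝ)..1, (1 - z ^ 2) ^ (p - 1) * (deriv f z ^ 2 * (1 - z ^ 2))) +
        p * (m * weightMass p 1) * Real.log ((m + ε) / m)) (𝓝[>] 0)
      (𝓝 (∫ z in (-1 : ℝ)..1, (1 - z ^ 2) ^ (p - 1) * (deriv f z ^ 2 * (1 - z ^ 2)))) := by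
    have hc : ContinuousAt (fun ε : ℝ => Real.log ((m + ε) / m)) 0 :=
      ContinuousAt.log (by fun_prop) (by simp [hmpos.ne'])
    have h := (hc.tendsto.const_mul (p * (m * weightMass p 1))).const_add
      (∫ z in (-1 : ℝ)..1, (1 - z ^ 2) ^ (p - 1) * (deriv f z ^ 2 * (1 - z ^ 2)))
    simp only [add_zero, div_self hmpos.ne', Real.log_one, mul_zero] at h
    exact tendsto_nhdsWithin_of_tendsto_nhds h
  exact ge_of_tendsto hlim (eventually_mem_nhdsWithin.mono fun ε hε => key ε hε)

theorem integrable_ultraspherical_iff {p Z : ℝ} (hZ : 0 < Z) (h : ℝ → ℝ) :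
    Integrable h ((volume.restrict (Icc (-1 : ℝ) 1)).withDensity
      fun z => ENNReal.ofReal ((1 - z ^ 2) ^ (p - 1) / Z)) ↔
    IntervalIntegrable (fun z => (1 - z ^ 2) ^ (p - 1) * h z) volume (-1) 1 := by
  have hmeas : Measurable fun z : ℝ => ENNReal.ofReal ((1 - z ^ 2) ^ (p - 1) / Z) := by
    fun_prop
  rw [integrable_withDensity_iff_integrable_smul' hmeas
      (Eventually.of_forall fun _ => ENNReal.ofReal_lt_top),
    intervalIntegrable_iff_integrableOn_Icc_of_le (by norm_num)]
  have e : (fun z => (ENNReal.ofReal ((1 - z ^ 2) ^ (p - 1) / Z)).toReal • h z)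
      =ᵐ[volume.restrict (Icc (-1 : ℝ) 1)] fun z => Z⁻¹ * ((1 - z ^ 2) ^ (p - 1) * h z) := by
    refine (ae_restrict_iff' measurableSet_Icc).2 (Eventually.of_forall fun z hz => ?_)
    have : 0 ≤ (1 - z ^ 2) ^ (p - 1) := Real.rpow_nonneg (by nlinarith [hz.1, hz.2]) _
    simp only [ENNReal.toReal_ofReal (div_nonneg this hZ.le), smul_eq_mul]
    ring
  rw [integrable_congr e]
  exact integrable_const_mul_iff (inv_ne_zero hZ.ne').isUnit _

theorem integral_ultraspherical {p Z : ℝ} (hZ : 0 < Z) (h : ℝ → ℝ) :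
    ∫ z, h z ∂((volume.restrict (Icc (-1 : ℝ) 1)).withDensity
      fun z => ENNReal.ofReal ((1 - z ^ 2) ^ (p - 1) / Z)) =
    Z⁻¹ * ∫ z in (-1 : ℝ)..1, (1 - z ^ 2) ^ (p - 1) * h z := by
  have hmeas : Measurable fun z : ℝ => ENNReal.ofReal ((1 - z ^ 2) ^ (p - 1) / Z) := by
    fun_prop
  rw [integral_withDensity_eq_integral_toReal_smul hmeas
      (Eventually.of_forall fun _ => ENNReal.ofReal_lt_top),
    intervalIntegral.integral_of_le (by norm_num), ← integral_Icc_eq_integral_Ioc,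
    ← integral_const_mul]
  refine setIntegral_congr_fun measurableSet_Icc fun z hz => ?_
  have : 0 ≤ (1 - z ^ 2) ^ (p - 1) := Real.rpow_nonneg (by nlinarith [hz.1, hz.2]) _
  simp only [ENNReal.toReal_ofReal (div_nonneg this hZ.le), smul_eq_mul]
  ring

theorem stmt_9 (n : ℝ) (hn : 0 < n)
    (ν : Measure ℝ)
    (hν : ν = (volume.restrict (Set.Icc (-1 : ℝ) 1)).withDensity
      (fun z => ENNReal.ofReal
        ((1 - z ^ 2) ^ ((n - 2) / 2) / (Real.sqrt π * Gamma (n / 2) / Gamma ((n + 1) / 2)))))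
    (f : ℝ → ℝ) (hf : Differentiable ℝ f) (hf0 : f ≠ 0)
    (hf2 : Integrable (fun z => (f z) ^ 2) ν)
    (hflog : Integrable (fun z => (f z) ^ 2 * Real.log ((f z) ^ 2 / ∫ y, (f y) ^ 2 ∂ν)) ν)
    (hf' : Integrable (fun z => (deriv f z) ^ 2 * (1 - z ^ 2)) ν) :
    ∫ z, (deriv f z) ^ 2 * (1 - z ^ 2) ∂ν
      ≥ n / 2 * ∫ z, (f z) ^ 2 * Real.log ((f z) ^ 2 / ∫ y, (f y) ^ 2 ∂ν) ∂ν := by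
  have hp : 0 < n / 2 := by positivity
  have hmass : Real.sqrt π * Gamma (n / 2) / Gamma ((n + 1) / 2) = weightMass (n / 2) 1 := by
    rw [weightMass, integral_weight hp, show n / 2 + 1 / 2 = (n + 1) / 2 by ring]
  have hZ : 0 < weightMass (n / 2) 1 := by
    rw [← hmass]
    have := Real.Gamma_pos_of_pos hp
    have := Real.Gamma_pos_of_pos (show 0 < (n + 1) / 2 by positivity)
    positivity
  rw [hmass, show (n - 2) / 2 = n / 2 - 1 by ring] at hν
  set m := ∫ y, (f y) ^ 2 ∂ν with hm
  have hmeq : ∫ z in (-1 : ℝ)..1, (1 - z ^ 2) ^ (n / 2 - 1) * f z ^ 2 =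
      m * weightMass (n / 2) 1 := by
    rw [hm, hν, integral_ultraspherical hZ]
    field_simp
  clear_value m
  subst hν
  rw [integrable_ultraspherical_iff hZ] at hflog hf'
  rw [integral_ultraspherical hZ, integral_ultraspherical hZ, ge_iff_le, mul_left_comm]
  exact mul_le_mul_of_nonneg_left (logSobolev_weight hp hf hmeq hflog hf') (inv_nonneg.2 hZ.le)
end
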